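/- arXiv:1611.06665 — 10 statements merged into one kernel-verified Lean document; each statement's English description precedes it below -/
import Mathlib

section
/- Under assumptions (A2), (A3) and (A4), the fractional-order interval implicit projection neural network has exactly one equilibrium point; that is, there exists a unique pair (x*, y*) ∈ R^n × R^m such that for every i = 1,…,n: x*_i = Σ_{j=1}^n h_ij x*_j + clamp( x*_i − ρ(Σ_{j=1}^n a_ij x*_j + Σ_{j=1}^m a*_ij y*_j) − ρ a_i − Σ_{j=1}^n h_ij x*_j ; c_{1,i}, c_{2,i} ), and for every j = 1,…,m: y*_j = Σ_{i=1}^m l_ji y*_i + clamp( y*_j − λ(Σ_{i=1}^m b_ji y*_i + Σ_{i=1}^n b*_ji x*_i) − λ b_j − Σ_{i=1}^m l_ji y*_i ; d_{1,j}, d_{2,j} ). -/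
noncomputable def clamp (s c d : ℝ) : ℝ := min (max s c) d

noncomputable def sgn (t : ℝ) : ℝ := if 0 < t then 1 else if t < 0 then -1 else 0

/-- A self-map of `ι → ℝ` whose componentwise Lipschitz matrix `M` has weighted column sums
smaller than the weights has exactly one fixed point. -/
theorem existsUnique_fixedPoint_of_weighted_colSum_lt {ι : Type*} [Fintype ι]
    (w : ι → ℝ) (hw : ∀ i, 0 < w i) (F : (ι → ℝ) → ι → ℝ) (M : ι → ι → ℝ)
    (hF : ∀ u v i, |F u i - F v i| ≤ ∑ j, M i j * |u j - v j|)
    (hM : ∀ j, ∑ i, w i * M i j < w j) :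
    ∃! u, F u = u := by
  classical
  set c : ι → NNReal := fun j => ((∑ i, w i * M i j) / w j).toNNReal with hc
  set K : NNReal := Finset.univ.sup c with hKdef
  have hK : K < 1 := by
    rw [hKdef, Finset.sup_lt_iff (by simp)]
    intro j _
    rw [hc, Real.toNNReal_lt_one, div_lt_one (hw j)]
    exact hM j
  have hcol : ∀ j, ∑ i, w i * M i j ≤ K * w j := by
    intro j
    rw [← div_le_iff₀ (hw j)]
    refine (Real.le_coe_toNNReal _).trans ?_
    exact_mod_cast Finset.le_sup (f := c) (Finset.mem_univ j)
  let G : PiLp 1 (fun _ : ι => ℝ) → PiLp 1 (fun _ : ι => ℝ) := fun z =>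
    WithLp.toLp 1 (fun i => w i * F (fun j => z j / w j) i)
  have hG : ContractingWith K G := by
    refine ⟨hK, LipschitzWith.of_dist_le_mul fun u v => ?_⟩
    rw [PiLp.dist_eq_of_L1, PiLp.dist_eq_of_L1]
    calc ∑ i, dist (G u i) (G v i)
        = ∑ i, w i * |F (fun j => u j / w j) i - F (fun j => v j / w j) i| := by
          refine Finset.sum_congr rfl fun i _ => ?_
          change |w i * _ - w i * _| = _
          rw [← mul_sub, abs_mul, abs_of_pos (hw i)]
      _ ≤ ∑ i, w i * ∑ j, M i j * |u j / w j - v j / w j| := by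
          gcongr with i _
          · exact (hw i).le
          · exact hF _ _ i
      _ = ∑ j, (∑ i, w i * M i j) * |u j / w j - v j / w j| := by
          simp_rw [Finset.mul_sum, Finset.sum_mul]
          rw [Finset.sum_comm]
          simp_rw [mul_assoc]
      _ ≤ ∑ j, (K * w j) * |u j / w j - v j / w j| := by
          gcongr with j _
          exact hcol j
      _ = K * ∑ j, dist (u j) (v j) := by
          rw [Finset.mul_sum]
          refine Finset.sum_congr rfl fun j _ => ?_
          rw [← sub_div, abs_div, abs_of_pos (hw j), Real.dist_eq, mul_assoc,
            mul_div_cancel₀ _ (hw j).ne']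
  refine ⟨fun i => hG.fixedPoint G i / w i, ?_, fun v hv => ?_⟩
  · funext i
    have h1 : w i * F (fun j => hG.fixedPoint G j / w j) i = hG.fixedPoint G i :=
      congrArg (fun z : PiLp 1 (fun _ : ι => ℝ) => z i) hG.fixedPoint_isFixedPt
    rw [eq_div_iff (hw i).ne', mul_comm]
    exact h1
  · have h2 : Function.IsFixedPt G (WithLp.toLp 1 fun i => w i * v i) := by
      have h3 : (fun j => w j * v j / w j) = v :=
        funext fun j => mul_div_cancel_left₀ _ (hw j).ne'
      simp only [Function.IsFixedPt, G, h3, hv]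
    funext i
    rw [← hG.fixedPoint_unique h2, eq_div_iff (hw i).ne', mul_comm]

theorem abs_clamp_sub_clamp_le (s t c d : ℝ) : |clamp s c d - clamp t c d| ≤ |s - t| :=
  (abs_inf_sub_inf_le_abs _ _ _).trans (abs_sup_sub_sup_le_abs _ _ _)

/-- The `x`-half of the implicit projection network; the `y`-half has the same shape. -/
noncomputable def implicitProjMap {n m : ℕ} (ρ : ℝ) (A : Fin n → Fin n → ℝ)
    (As : Fin n → Fin m → ℝ) (a : Fin n → ℝ) (h : Fin n → Fin n → ℝ) (c1 c2 : Fin n → ℝ)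
    (x : Fin n → ℝ) (y : Fin m → ℝ) (i : Fin n) : ℝ :=
  (∑ j, h i j * x j) + clamp (x i - ρ * ((∑ j, A i j * x j) + (∑ j, As i j * y j)) - ρ * a i
    - (∑ j, h i j * x j)) (c1 i) (c2 i)

theorem abs_implicitProjMap_sub_le {n m : ℕ} {ρ : ℝ} (hρ : 0 < ρ) (A : Fin n → Fin n → ℝ)
    (As : Fin n → Fin m → ℝ) (a : Fin n → ℝ) (h : Fin n → Fin n → ℝ) (c1 c2 : Fin n → ℝ)
    (x x' : Fin n → ℝ) (y y' : Fin m → ℝ) (i : Fin n) :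
    |implicitProjMap ρ A As a h c1 c2 x y i - implicitProjMap ρ A As a h c1 c2 x' y' i| ≤
      ∑ j, (|h i j| + |(if i = j then 1 else 0) - ρ * A i j - h i j|) * |x j - x' j|
        + ∑ j, ρ * |As i j| * |y j - y' j| := by
  have h1 : ∑ j, h i j * x j - ∑ j, h i j * x' j = ∑ j, h i j * (x j - x' j) := by
    simp_rw [mul_sub, Finset.sum_sub_distrib]
  have h2 : (x i - ρ * ((∑ j, A i j * x j) + (∑ j, As i j * y j)) - ρ * a i
        - (∑ j, h i j * x j))
      - (x' i - ρ * ((∑ j, A i j * x' j) + (∑ j, As i j * y' j)) - ρ * a i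
        - (∑ j, h i j * x' j))
      = ∑ j, ((if i = j then 1 else 0) - ρ * A i j - h i j) * (x j - x' j)
        - ∑ j, ρ * As i j * (y j - y' j) := by
    simp_rw [mul_sub, sub_mul, Finset.sum_sub_distrib, ite_mul, one_mul, zero_mul,
      Finset.sum_ite_eq, Finset.mem_univ, if_true, mul_assoc, ← Finset.mul_sum]
    ring
  have h3 := abs_clamp_sub_clamp_le
    (x i - ρ * ((∑ j, A i j * x j) + (∑ j, As i j * y j)) - ρ * a i - (∑ j, h i j * x j))
    (x' i - ρ * ((∑ j, A i j * x' j) + (∑ j, As i j * y' j)) - ρ * a i - (∑ j, h i j * x' j))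
    (c1 i) (c2 i)
  rw [h2] at h3
  have abs_sum : ∀ {k : ℕ} (f g : Fin k → ℝ), |∑ j, f j * g j| ≤ ∑ j, |f j| * |g j| :=
    fun f g => (Finset.abs_sum_le_sum_abs _ _).trans_eq (by simp_rw [abs_mul])
  have h4 := abs_sum (h i) (fun j => x j - x' j)
  have h5 := abs_sum (fun j => (if i = j then 1 else 0) - ρ * A i j - h i j)
    (fun j => x j - x' j)
  have h6 := abs_sum (fun j => ρ * As i j) (fun j => y j - y' j)
  simp_rw [abs_mul, abs_of_pos hρ] at h6
  simp_rw [add_mul, Finset.sum_add_distrib]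
  rw [implicitProjMap, implicitProjMap, add_sub_add_comm, h1]
  refine (abs_add_le _ _).trans ?_
  have h7 := h3.trans (abs_sub _ _)
  linarith

/-- The weighted column sums of the Lipschitz matrix of the network are smaller than the
weights. -/
theorem weighted_colSum_lt {n m : ℕ} {ρ lam : ℝ} (hρ : 0 < ρ) (hlam : 0 < lam)
    (Al Au A h : Fin n → Fin n → ℝ) (hAb : ∀ i j, Al i j ≤ A i j ∧ A i j ≤ Au i j)
    (Bsl Bsu Bs : Fin m → Fin n → ℝ) (hBsb : ∀ j i, Bsl j i ≤ Bs j i ∧ Bs j i ≤ Bsu j i)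
    (hA2 : ∀ i, 1 - ρ * Au i i ≥ h i i)
    (μ : Fin n → ℝ) (τ : Fin m → ℝ) (hμ : ∀ i, 0 < μ i) (hτ : ∀ j, 0 < τ j) (i : Fin n)
    (hξ : 1 - ρ * Al i i - h i i + |h i i|
        + ∑ j ∈ Finset.univ.erase i, (μ j / μ i) *
          (max |ρ * Al j i + h j i| |ρ * Au j i + h j i| + |h j i|)
        + ∑ j, (τ j / μ i) * (lam * max |Bsl j i| |Bsu j i|) < 1) :
    ∑ j, μ j * (|h j i| + |(if j = i then 1 else 0) - ρ * A j i - h j i|)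
      + ∑ j, τ j * (lam * |Bs j i|) < μ i := by
  have hdiag : |1 - ρ * A i i - h i i| ≤ 1 - ρ * Al i i - h i i := by
    have h1 := mul_le_mul_of_nonneg_left (hAb i i).1 hρ.le
    have h2 := mul_le_mul_of_nonneg_left (hAb i i).2 hρ.le
    have h3 := hA2 i
    rw [abs_of_nonneg] <;> linarith
  have hoff : ∑ j ∈ Finset.univ.erase i,
        μ j * (|h j i| + |(if j = i then 1 else 0) - ρ * A j i - h j i|) ≤
      μ i * ∑ j ∈ Finset.univ.erase i, (μ j / μ i) *
          (max |ρ * Al j i + h j i| |ρ * Au j i + h j i| + |h j i|) := by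
    rw [Finset.mul_sum]
    refine Finset.sum_le_sum fun j hj => ?_
    rw [← mul_assoc, mul_div_cancel₀ _ (hμ i).ne', if_neg (Finset.ne_of_mem_erase hj)]
    refine mul_le_mul_of_nonneg_left ?_ (hμ j).le
    have h1 := mul_le_mul_of_nonneg_left (hAb j i).1 hρ.le
    have h2 := mul_le_mul_of_nonneg_left (hAb j i).2 hρ.le
    have h3 : |0 - ρ * A j i - h j i| = |ρ * A j i + h j i| := by
      rw [← abs_neg]; ring_nf
    have h4 : |ρ * A j i + h j i| ≤ max |ρ * Al j i + h j i| |ρ * Au j i + h j i| :=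
      abs_le_max_abs_abs (by linarith) (by linarith)
    linarith
  have hcross : ∑ j, τ j * (lam * |Bs j i|) ≤
      μ i * ∑ j, (τ j / μ i) * (lam * max |Bsl j i| |Bsu j i|) := by
    rw [Finset.mul_sum]
    refine Finset.sum_le_sum fun j _ => ?_
    rw [← mul_assoc (μ i), mul_div_cancel₀ _ (hμ i).ne']
    have h1 := abs_le_max_abs_abs (hBsb j i).1 (hBsb j i).2
    have h2 := hτ j
    gcongr
  have hlt := mul_lt_mul_of_pos_left hξ (hμ i)
  have hd := mul_le_mul_of_nonneg_left hdiag (hμ i).le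
  rw [← Finset.add_sum_erase _ _ (Finset.mem_univ i), if_pos rfl]
  linarith

theorem stmt0
    (n m : ℕ) (hn : 0 < n) (hm : 0 < m)
    (ρ lam : ℝ) (hρ : 0 < ρ) (hlam : 0 < lam)
    (a : Fin n → ℝ) (b : Fin m → ℝ)
    (Al Au A : Fin n → Fin n → ℝ)
    (Asl Asu As : Fin n → Fin m → ℝ)
    (hAb : ∀ i j, Al i j ≤ A i j ∧ A i j ≤ Au i j)
    (hAsb : ∀ i j, Asl i j ≤ As i j ∧ As i j ≤ Asu i j)
    (Bl Bu B : Fin m → Fin m → ℝ)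
    (Bsl Bsu Bs : Fin m → Fin n → ℝ)
    (hBb : ∀ i j, Bl i j ≤ B i j ∧ B i j ≤ Bu i j)
    (hBsb : ∀ j i, Bsl j i ≤ Bs j i ∧ Bs j i ≤ Bsu j i)
    (h : Fin n → Fin n → ℝ)
    (l : Fin m → Fin m → ℝ)
    (c1 c2 : Fin n → ℝ) (hc : ∀ i, c1 i ≤ c2 i)
    (d1 d2 : Fin m → ℝ) (hd : ∀ j, d1 j ≤ d2 j)
    (atil : Fin n → Fin n → ℝ)
    (hatil : ∀ j i, atil j i = max |ρ * Al j i + h j i| |ρ * Au j i + h j i|)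
    (astil : Fin n → Fin m → ℝ)
    (hastil : ∀ i j, astil i j = max |Asl i j| |Asu i j|)
    (btil : Fin m → Fin m → ℝ)
    (hbtil : ∀ i j, btil i j = max |lam * Bl i j + l i j| |lam * Bu i j + l i j|)
    (bstil : Fin m → Fin n → ℝ)
    (hbstil : ∀ j i, bstil j i = max |Bsl j i| |Bsu j i|)
    (hA2 : ∀ i, 1 - ρ * Au i i ≥ h i i)
    (hA3 : ∀ j, 1 - lam * Bu j j ≥ l j j)
    (μ : Fin n → ℝ) (τ : Fin m → ℝ)
    (hμ : ∀ i, 0 < μ i) (hτ : ∀ j, 0 < τ j)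
    (ξ : Fin n → ℝ)
    (hξdef : ∀ i, ξ i = 1 - ρ * Al i i - h i i + |h i i|
        + ∑ j ∈ Finset.univ.erase i, (μ j / μ i) * (atil j i + |h j i|)
        + ∑ j, (τ j / μ i) * (lam * bstil j i))
    (ζ : Fin m → ℝ)
    (hζdef : ∀ j, ζ j = 1 - lam * Bl j j - l j j + |l j j|
        + ∑ i ∈ Finset.univ.erase j, (τ i / τ j) * (btil i j + |l i j|)
        + ∑ i, (μ i / τ j) * (ρ * astil i j))
    (hA4 : (∀ i, 0 < ξ i ∧ ξ i < 1) ∧ (∀ j, 0 < ζ j ∧ ζ j < 1))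
    :
    ∃! p : (Fin n → ℝ) × (Fin m → ℝ),
      (∀ i, p.1 i = (∑ j, h i j * p.1 j)
          + clamp (p.1 i - ρ * ((∑ j, A i j * p.1 j) + (∑ j, As i j * p.2 j)) - ρ * a i
              - (∑ j, h i j * p.1 j)) (c1 i) (c2 i)) ∧
      (∀ j, p.2 j = (∑ i, l j i * p.2 i)
          + clamp (p.2 j - lam * ((∑ i, B j i * p.2 i) + (∑ i, Bs j i * p.1 i)) - lam * b j
              - (∑ i, l j i * p.2 i)) (d1 j) (d2 j)) := by
  let F : (Fin n ⊕ Fin m → ℝ) → Fin n ⊕ Fin m → ℝ := fun u =>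
    Sum.elim (implicitProjMap ρ A As a h c1 c2 (u ∘ Sum.inl) (u ∘ Sum.inr))
      (implicitProjMap lam B Bs b l d1 d2 (u ∘ Sum.inr) (u ∘ Sum.inl))
  let M : Fin n ⊕ Fin m → Fin n ⊕ Fin m → ℝ := Sum.elim
    (fun i => Sum.elim
      (fun j => |h i j| + |(if i = j then 1 else 0) - ρ * A i j - h i j|)
      (fun j => ρ * |As i j|))
    (fun i => Sum.elim
      (fun j => lam * |Bs i j|)
      (fun j => |l i j| + |(if i = j then 1 else 0) - lam * B i j - l i j|))
  obtain ⟨u, hu, huniq⟩ := existsUnique_fixedPoint_of_weighted_colSum_lt (Sum.elim μ τ)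
    (by rintro (i | j); exacts [hμ i, hτ j]) F M
    (by
      rintro u v (i | j)
      · rw [Fintype.sum_sum_type]
        exact abs_implicitProjMap_sub_le hρ A As a h c1 c2 _ _ _ _ i
      · rw [Fintype.sum_sum_type, add_comm]
        exact abs_implicitProjMap_sub_le hlam B Bs b l d1 d2 _ _ _ _ j)
    (by
      rintro (i | j)
      · rw [Fintype.sum_sum_type]
        refine weighted_colSum_lt hρ hlam Al Au A h hAb Bsl Bsu Bs hBsb hA2 μ τ hμ hτ i ?_
        simpa only [hξdef, hatil, hbstil] using (hA4.1 i).2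
      · rw [Fintype.sum_sum_type, add_comm]
        refine weighted_colSum_lt hlam hρ Bl Bu B l hBb Asl Asu As hAsb hA3 τ μ hτ hμ j ?_
        simpa only [hζdef, hbtil, hastil] using (hA4.2 j).2)
  refine ⟨(u ∘ Sum.inl, u ∘ Sum.inr),
    ⟨fun i => (congrFun hu (Sum.inl i)).symm, fun j => (congrFun hu (Sum.inr j)).symm⟩, ?_⟩
  rintro ⟨x, y⟩ ⟨hx, hy⟩
  have hxy : Sum.elim x y = u := by
    apply huniq
    funext k
    rcases k with i | j
    exacts [(hx i).symm, (hy j).symm]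
  simp [← hxy]
end

section
/- Assume (A2) and (A3) and fix weights μ_i > 0 and τ_j > 0. Then for all (x¹, y¹), (x², y²) ∈ R^n × R^m one has Σ_{i=1}^n |T_{ρ,i}(x², y²) − T_{ρ,i}(x¹, y¹)| + Σ_{j=1}^m |T_{λ,j}(x², y²) − T_{λ,j}(x¹, y¹)| ≤ Σ_{i=1}^n ξ_i |x²_i − x¹_i| + Σ_{j=1}^m ζ_j |y²_j − y¹_j|, where ξ_i := 1 − ρ a̲_ii − h_ii + |h_ii| + Σ_{j≠i} (μ_j/μ_i)(ã_ji + |h_ji|) + Σ_{j=1}^m (τ_j/μ_i) λ b̃*_ji and ζ_j := 1 − λ b̲_jj − l_jj + |l_jj| + Σ_{i≠j} (τ_i/τ_j)(b̃_ij + |l_ij|) + Σ_{i=1}^n (μ_i/τ_j) ρ ã*_ij. -/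
theorem abs_mul_div_le {k t u w : ℝ} (hk : |k| ≤ t) (hw : 0 < w) :
    |k * (u / w)| ≤ t * (|u| / w) := by
  rw [abs_mul, abs_div, abs_of_pos hw]
  gcongr

theorem abs_sum_mul_div_sub_le {ι : Type*} (S : Finset ι) (k t u v w : ι → ℝ)
    (hk : ∀ j, |k j| ≤ t j) (hw : ∀ j, 0 < w j) :
    |(∑ j ∈ S, k j * (u j / w j)) - ∑ j ∈ S, k j * (v j / w j)|
      ≤ ∑ j ∈ S, t j * (|u j - v j| / w j) := by
  rw [← Finset.sum_sub_distrib]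
  refine (Finset.abs_sum_le_sum_abs _ _).trans (Finset.sum_le_sum fun j _ => ?_)
  rw [← mul_sub, ← sub_div]
  exact abs_mul_div_le (hk j) (hw j)

/-- A single component of the weighted projection operator is Lipschitz, with the diagonal
coefficient kept separate from the off-diagonal ones. -/
theorem abs_component_sub_le {ι κ : Type*} [Fintype ι] [DecidableEq ι] [Fintype κ]
    (i : ι) (h K t : ι → ℝ) (E s : κ → ℝ) (D e c d : ℝ) (μ : ι → ℝ) (τ : κ → ℝ)
    (hμ : ∀ i, 0 < μ i) (hτ : ∀ j, 0 < τ j)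
    (hK0 : 0 ≤ 1 - K i) (hKD : 1 - K i ≤ D) (hKt : ∀ j, |K j| ≤ t j) (hEs : ∀ j, |E j| ≤ s j)
    (x1 x2 : ι → ℝ) (y1 y2 : κ → ℝ) :
    |μ i * ((∑ j, h j * (x2 j / μ j)) + clamp (x2 i / μ i - (∑ j, K j * (x2 j / μ j))
          - (∑ j, E j * (y2 j / τ j)) - e) c d)
      - μ i * ((∑ j, h j * (x1 j / μ j)) + clamp (x1 i / μ i - (∑ j, K j * (x1 j / μ j))
          - (∑ j, E j * (y1 j / τ j)) - e) c d)|
      ≤ (D + |h i|) * |x2 i - x1 i|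
        + ∑ j ∈ Finset.univ.erase i, (μ i / μ j) * (t j + |h j|) * |x2 j - x1 j|
        + ∑ j, (μ i / τ j) * s j * |y2 j - y1 j| := by
  have hi := hμ i
  rw [← mul_sub, abs_mul, abs_of_pos hi]
  have hh := abs_sum_mul_div_sub_le Finset.univ h (fun j => |h j|) x2 x1 μ (fun _ => le_rfl) hμ
  have hk := abs_sum_mul_div_sub_le (Finset.univ.erase i) K t x2 x1 μ hKt hμ
  have he := abs_sum_mul_div_sub_le Finset.univ E s y2 y1 τ hEs hτ
  have hd : |(1 - K i) * ((x2 i - x1 i) / μ i)| ≤ D * (|x2 i - x1 i| / μ i) :=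
    abs_mul_div_le (by rwa [abs_of_nonneg hK0]) hi
  rw [← Finset.add_sum_erase _ (fun j => |h j| * (|x2 j - x1 j| / μ j)) (Finset.mem_univ i)] at hh
  have hcl := abs_clamp_sub_clamp_le
    (x2 i / μ i - (∑ j, K j * (x2 j / μ j)) - (∑ j, E j * (y2 j / τ j)) - e)
    (x1 i / μ i - (∑ j, K j * (x1 j / μ j)) - (∑ j, E j * (y1 j / τ j)) - e) c d
  have hw : (x2 i / μ i - (∑ j, K j * (x2 j / μ j)) - (∑ j, E j * (y2 j / τ j)) - e)
      - (x1 i / μ i - (∑ j, K j * (x1 j / μ j)) - (∑ j, E j * (y1 j / τ j)) - e)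
      = (1 - K i) * ((x2 i - x1 i) / μ i)
        - ((∑ j ∈ Finset.univ.erase i, K j * (x2 j / μ j))
          - ∑ j ∈ Finset.univ.erase i, K j * (x1 j / μ j))
        - ((∑ j, E j * (y2 j / τ j)) - ∑ j, E j * (y1 j / τ j)) := by
    rw [← Finset.add_sum_erase _ (fun j => K j * (x2 j / μ j)) (Finset.mem_univ i),
      ← Finset.add_sum_erase _ (fun j => K j * (x1 j / μ j)) (Finset.mem_univ i)]
    ring
  have hrhs : (D + |h i|) * |x2 i - x1 i|
        + ∑ j ∈ Finset.univ.erase i, (μ i / μ j) * (t j + |h j|) * |x2 j - x1 j|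
        + ∑ j, (μ i / τ j) * s j * |y2 j - y1 j|
      = μ i * ((|h i| * (|x2 i - x1 i| / μ i)
          + ∑ j ∈ Finset.univ.erase i, |h j| * (|x2 j - x1 j| / μ j))
        + (D * (|x2 i - x1 i| / μ i) + ∑ j ∈ Finset.univ.erase i, t j * (|x2 j - x1 j| / μ j)
          + ∑ j, s j * (|y2 j - y1 j| / τ j))) := by
    have h1 : ∑ j ∈ Finset.univ.erase i, (μ i / μ j) * (t j + |h j|) * |x2 j - x1 j|
        = μ i * (∑ j ∈ Finset.univ.erase i, |h j| * (|x2 j - x1 j| / μ j))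
          + μ i * ∑ j ∈ Finset.univ.erase i, t j * (|x2 j - x1 j| / μ j) := by
      rw [Finset.mul_sum, Finset.mul_sum, ← Finset.sum_add_distrib]
      exact Finset.sum_congr rfl fun j _ => by ring
    have h2 : ∑ j, (μ i / τ j) * s j * |y2 j - y1 j|
        = μ i * ∑ j, s j * (|y2 j - y1 j| / τ j) := by
      rw [Finset.mul_sum]
      exact Finset.sum_congr rfl fun j _ => by ring
    rw [h1, h2]
    field_simp
    ring
  rw [hrhs]
  refine mul_le_mul_of_nonneg_left ?_ hi.le
  rw [add_sub_add_comm]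
  refine (abs_add_le _ _).trans (add_le_add hh (hcl.trans ?_))
  rw [hw]
  exact (abs_sub _ _).trans (add_le_add ((abs_sub _ _).trans (add_le_add hd hk)) he)

/-- Summing the componentwise estimates and collecting coefficients by input coordinate. -/
theorem sum_abs_component_sub_le {ι κ : Type*} [Fintype ι] [DecidableEq ι] [Fintype κ]
    (h K t : ι → ι → ℝ) (E s : ι → κ → ℝ) (D e c d : ι → ℝ) (μ : ι → ℝ) (τ : κ → ℝ)
    (hμ : ∀ i, 0 < μ i) (hτ : ∀ j, 0 < τ j)
    (hK0 : ∀ i, 0 ≤ 1 - K i i) (hKD : ∀ i, 1 - K i i ≤ D i)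
    (hKt : ∀ i j, |K i j| ≤ t i j) (hEs : ∀ i j, |E i j| ≤ s i j)
    (x1 x2 : ι → ℝ) (y1 y2 : κ → ℝ) :
    ∑ i, |μ i * ((∑ j, h i j * (x2 j / μ j)) + clamp (x2 i / μ i - (∑ j, K i j * (x2 j / μ j))
          - (∑ j, E i j * (y2 j / τ j)) - e i) (c i) (d i))
      - μ i * ((∑ j, h i j * (x1 j / μ j)) + clamp (x1 i / μ i - (∑ j, K i j * (x1 j / μ j))
          - (∑ j, E i j * (y1 j / τ j)) - e i) (c i) (d i))|
      ≤ ∑ i, (D i + |h i i| + ∑ j ∈ Finset.univ.erase i, (μ j / μ i) * (t j i + |h j i|))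
            * |x2 i - x1 i|
        + ∑ j, (∑ i, (μ i / τ j) * s i j) * |y2 j - y1 j| := by
  refine (Finset.sum_le_sum fun i _ => abs_component_sub_le i (h i) (K i) (t i) (E i) (s i)
    (D i) (e i) (c i) (d i) μ τ hμ hτ (hK0 i) (hKD i) (hKt i) (hEs i) x1 x2 y1 y2).trans_eq ?_
  simp only [add_mul _ (∑ _ ∈ _, _), Finset.sum_add_distrib, Finset.sum_mul]
  congr 1
  · congr 1
    exact Finset.sum_comm' (by simp [eq_comm])
  · exact Finset.sum_comm

theorem abs_mul_add_le_max_abs {r p q k v : ℝ} (hr : 0 ≤ r) (hpk : p ≤ k) (hkq : k ≤ q) :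
    |r * k + v| ≤ max |r * p + v| |r * q + v| :=
  abs_le_max_abs_abs (by gcongr) (by gcongr)

theorem abs_mul_le_mul_max_abs {r p q k : ℝ} (hr : 0 ≤ r) (hpk : p ≤ k) (hkq : k ≤ q) :
    |r * k| ≤ r * max |p| |q| := by
  rw [abs_mul, abs_of_nonneg hr]
  exact mul_le_mul_of_nonneg_left (abs_le_max_abs_abs hpk hkq) hr

theorem stmt1
    (n m : ℕ) (hn : 0 < n) (hm : 0 < m)
    (ρ lam : ℝ) (hρ : 0 < ρ) (hlam : 0 < lam)
    (a : Fin n → ℝ) (b : Fin m → ℝ)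
    (Al Au A : Fin n → Fin n → ℝ)
    (Asl Asu As : Fin n → Fin m → ℝ)
    (hAb : ∀ i j, Al i j ≤ A i j ∧ A i j ≤ Au i j)
    (hAsb : ∀ i j, Asl i j ≤ As i j ∧ As i j ≤ Asu i j)
    (Bl Bu B : Fin m → Fin m → ℝ)
    (Bsl Bsu Bs : Fin m → Fin n → ℝ)
    (hBb : ∀ i j, Bl i j ≤ B i j ∧ B i j ≤ Bu i j)
    (hBsb : ∀ j i, Bsl j i ≤ Bs j i ∧ Bs j i ≤ Bsu j i)
    (h : Fin n → Fin n → ℝ)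
    (l : Fin m → Fin m → ℝ)
    (c1 c2 : Fin n → ℝ) (hc : ∀ i, c1 i ≤ c2 i)
    (d1 d2 : Fin m → ℝ) (hd : ∀ j, d1 j ≤ d2 j)
    (atil : Fin n → Fin n → ℝ)
    (hatil : ∀ j i, atil j i = max |ρ * Al j i + h j i| |ρ * Au j i + h j i|)
    (astil : Fin n → Fin m → ℝ)
    (hastil : ∀ i j, astil i j = max |Asl i j| |Asu i j|)
    (btil : Fin m → Fin m → ℝ)
    (hbtil : ∀ i j, btil i j = max |lam * Bl i j + l i j| |lam * Bu i j + l i j|)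
    (bstil : Fin m → Fin n → ℝ)
    (hbstil : ∀ j i, bstil j i = max |Bsl j i| |Bsu j i|)
    (hA2 : ∀ i, 1 - ρ * Au i i ≥ h i i)
    (hA3 : ∀ j, 1 - lam * Bu j j ≥ l j j)
    (μ : Fin n → ℝ) (τ : Fin m → ℝ)
    (hμ : ∀ i, 0 < μ i) (hτ : ∀ j, 0 < τ j)
    (ξ : Fin n → ℝ)
    (hξdef : ∀ i, ξ i = 1 - ρ * Al i i - h i i + |h i i|
        + ∑ j ∈ Finset.univ.erase i, (μ j / μ i) * (atil j i + |h j i|)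
        + ∑ j, (τ j / μ i) * (lam * bstil j i))
    (ζ : Fin m → ℝ)
    (hζdef : ∀ j, ζ j = 1 - lam * Bl j j - l j j + |l j j|
        + ∑ i ∈ Finset.univ.erase j, (τ i / τ j) * (btil i j + |l i j|)
        + ∑ i, (μ i / τ j) * (ρ * astil i j))
    (Tρ : (Fin n → ℝ) → (Fin m → ℝ) → Fin n → ℝ)
    (hTρ : ∀ x y i, Tρ x y i = μ i * ((∑ j, h i j * (x j / μ j))
        + clamp (x i / μ i - (∑ j, (ρ * A i j + h i j) * (x j / μ j))
            - (∑ j, ρ * As i j * (y j / τ j)) - ρ * a i) (c1 i) (c2 i)))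
    (Tlam : (Fin n → ℝ) → (Fin m → ℝ) → Fin m → ℝ)
    (hTlam : ∀ x y j, Tlam x y j = τ j * ((∑ i, l j i * (y i / τ i))
        + clamp (y j / τ j - (∑ i, (lam * B j i + l j i) * (y i / τ i))
            - (∑ i, lam * Bs j i * (x i / μ i)) - lam * b j) (d1 j) (d2 j)))
    :
    ∀ (x1 x2 : Fin n → ℝ) (y1 y2 : Fin m → ℝ),
      (∑ i, |Tρ x2 y2 i - Tρ x1 y1 i|) + (∑ j, |Tlam x2 y2 j - Tlam x1 y1 j|)
        ≤ (∑ i, ξ i * |x2 i - x1 i|) + (∑ j, ζ j * |y2 j - y1 j|) := by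
  intro x1 x2 y1 y2
  have hx := sum_abs_component_sub_le h (fun i j => ρ * A i j + h i j) atil
    (fun i j => ρ * As i j) (fun i j => ρ * astil i j) (fun i => 1 - ρ * Al i i - h i i)
    (fun i => ρ * a i) c1 c2 μ τ hμ hτ
    (fun i => by
      have := mul_le_mul_of_nonneg_left (hAb i i).2 hρ.le
      linarith [hA2 i])
    (fun i => by
      have := mul_le_mul_of_nonneg_left (hAb i i).1 hρ.le
      linarith)
    (fun i j => by
      rw [hatil]
      exact abs_mul_add_le_max_abs hρ.le (hAb i j).1 (hAb i j).2)
    (fun i j => by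
      rw [hastil]
      exact abs_mul_le_mul_max_abs hρ.le (hAsb i j).1 (hAsb i j).2)
    x1 x2 y1 y2
  have hy := sum_abs_component_sub_le l (fun i j => lam * B i j + l i j) btil
    (fun i j => lam * Bs i j) (fun i j => lam * bstil i j) (fun i => 1 - lam * Bl i i - l i i)
    (fun i => lam * b i) d1 d2 τ μ hτ hμ
    (fun i => by
      have := mul_le_mul_of_nonneg_left (hBb i i).2 hlam.le
      linarith [hA3 i])
    (fun i => by
      have := mul_le_mul_of_nonneg_left (hBb i i).1 hlam.le
      linarith)
    (fun i j => by
      rw [hbtil]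
      exact abs_mul_add_le_max_abs hlam.le (hBb i j).1 (hBb i j).2)
    (fun i j => by
      rw [hbstil]
      exact abs_mul_le_mul_max_abs hlam.le (hBsb i j).1 (hBsb i j).2)
    y1 y2 x1 x2
  simp only [hTρ, hTlam, hξdef, hζdef]
  refine (add_le_add hx hy).trans_eq ?_
  simp only [add_mul _ (∑ _, _), Finset.sum_add_distrib]
  ring
end

section
/- Assume (A2), (A3) and (A4), and set κ := max{ max_{1≤i≤n} ξ_i, max_{1≤j≤m} ζ_j }. Then 0 < κ < 1, the map T_{ρλ}(x, y) := ((T_{ρ,i}(x, y))_{i=1}^n, (T_{λ,j}(x, y))_{j=1}^m) satisfies ‖T_{ρλ}(x², y²) − T_{ρλ}(x¹, y¹)‖₁ ≤ κ ‖(x² − x¹, y² − y¹)‖₁ for all (x¹, y¹), (x², y²) ∈ R^n × R^m (where ‖(x, y)‖₁ := Σ_i |x_i| + Σ_j |y_j|), and consequently T_{ρλ} has a unique fixed point in R^n × R^m. -/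
/-- Componentwise increment bound for a clamped affine map in weighted coordinates. -/
theorem abs_weighted_clamp_sub_le {ι κ : Type*} [Fintype ι] [DecidableEq ι] [Fintype κ]
    {w : ι → ℝ} {v : κ → ℝ} (hw : ∀ i, 0 < w i) (hv : ∀ k, 0 < v k)
    (H P : ι → ℝ) (Q : κ → ℝ) (e c d : ℝ) (i : ι) (x1 x2 : ι → ℝ) (y1 y2 : κ → ℝ) :
    |w i * ((∑ j, H j * (x2 j / w j))
        + clamp (x2 i / w i - (∑ j, P j * (x2 j / w j)) - (∑ k, Q k * (y2 k / v k)) - e) c d)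
      - w i * ((∑ j, H j * (x1 j / w j))
        + clamp (x1 i / w i - (∑ j, P j * (x1 j / w j)) - (∑ k, Q k * (y1 k / v k)) - e) c d)|
    ≤ (|1 - P i| + |H i|) * |x2 i - x1 i|
      + ∑ j ∈ Finset.univ.erase i, (w i / w j) * (|P j| + |H j|) * |x2 j - x1 j|
      + ∑ k, (w i / v k) * |Q k| * |y2 k - y1 k| := by
  have key : ∀ p q r s : ℝ, |w i * (p + clamp q c d) - w i * (r + clamp s c d)|
      ≤ w i * (|p - r| + |q - s|) := by
    intro p q r s
    rw [← mul_sub, abs_mul, abs_of_pos (hw i), add_sub_add_comm]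
    exact mul_le_mul_of_nonneg_left ((abs_add_le _ _).trans
      (add_le_add_right (abs_clamp_sub_clamp_le _ _ _ _) _)) (hw i).le
  refine (key _ _ _ _).trans ?_
  have hH : (∑ j, H j * (x2 j / w j)) - (∑ j, H j * (x1 j / w j))
      = H i * ((x2 i - x1 i) / w i)
        + ∑ j ∈ Finset.univ.erase i, H j * ((x2 j - x1 j) / w j) := by
    rw [Finset.add_sum_erase _ (fun j => H j * ((x2 j - x1 j) / w j)) (Finset.mem_univ i),
      ← Finset.sum_sub_distrib]
    exact Finset.sum_congr rfl fun j _ => by ring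
  have hP : (∑ j, P j * (x2 j / w j)) - (∑ j, P j * (x1 j / w j))
      = P i * ((x2 i - x1 i) / w i)
        + ∑ j ∈ Finset.univ.erase i, P j * ((x2 j - x1 j) / w j) := by
    rw [Finset.add_sum_erase _ (fun j => P j * ((x2 j - x1 j) / w j)) (Finset.mem_univ i),
      ← Finset.sum_sub_distrib]
    exact Finset.sum_congr rfl fun j _ => by ring
  have hQ : (∑ k, Q k * (y2 k / v k)) - (∑ k, Q k * (y1 k / v k))
      = ∑ k, Q k * ((y2 k - y1 k) / v k) := by
    rw [← Finset.sum_sub_distrib]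
    exact Finset.sum_congr rfl fun j _ => by ring
  have hdiff : (x2 i / w i - (∑ j, P j * (x2 j / w j)) - (∑ k, Q k * (y2 k / v k)) - e)
      - (x1 i / w i - (∑ j, P j * (x1 j / w j)) - (∑ k, Q k * (y1 k / v k)) - e)
      = (1 - P i) * ((x2 i - x1 i) / w i)
        - ∑ j ∈ Finset.univ.erase i, P j * ((x2 j - x1 j) / w j)
        - ∑ k, Q k * ((y2 k - y1 k) / v k) := by
    rw [← hQ]
    linear_combination -hP
  rw [hH, hdiff]
  have hsumP := Finset.abs_sum_le_sum_abs (fun j => P j * ((x2 j - x1 j) / w j))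
    (Finset.univ.erase i)
  have hsumH := Finset.abs_sum_le_sum_abs (fun j => H j * ((x2 j - x1 j) / w j))
    (Finset.univ.erase i)
  have hsumQ := Finset.abs_sum_le_sum_abs (fun k => Q k * ((y2 k - y1 k) / v k)) Finset.univ
  have h1 := abs_add_le (H i * ((x2 i - x1 i) / w i))
    (∑ j ∈ Finset.univ.erase i, H j * ((x2 j - x1 j) / w j))
  have h2 := abs_sub ((1 - P i) * ((x2 i - x1 i) / w i)
    - ∑ j ∈ Finset.univ.erase i, P j * ((x2 j - x1 j) / w j))
    (∑ k, Q k * ((y2 k - y1 k) / v k))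
  have h3 := abs_sub ((1 - P i) * ((x2 i - x1 i) / w i))
    (∑ j ∈ Finset.univ.erase i, P j * ((x2 j - x1 j) / w j))
  have hbound := mul_le_mul_of_nonneg_left (add_le_add (h1.trans (add_le_add_right hsumH _))
    (h2.trans (add_le_add (h3.trans (add_le_add_right hsumP _)) hsumQ))) (hw i).le
  refine hbound.trans_eq ?_
  have hwi := (hw i).ne'
  simp only [abs_mul, abs_div, abs_of_pos (hw _), abs_of_pos (hv _), mul_add, add_mul,
    Finset.mul_sum, Finset.sum_add_distrib]
  have e1 : ∀ r s : ℝ, w i * (r * (s / w i)) = r * s := fun r s => by field_simp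
  have e2 : ∀ r s t : ℝ, w i * (r * (s / t)) = w i / t * r * s := fun r s t => by ring
  rw [e1, e1]
  simp only [e2]
  ring

/-- The `ℓ¹` increment bound for a clamped affine map in weighted coordinates, with the
coefficients collected by column. -/
theorem sum_abs_weighted_clamp_sub_le {ι κ : Type*} [Fintype ι] [DecidableEq ι] [Fintype κ]
    {w : ι → ℝ} {v : κ → ℝ} (hw : ∀ i, 0 < w i) (hv : ∀ k, 0 < v k)
    (H P : ι → ι → ℝ) (Q : ι → κ → ℝ) (e c d : ι → ℝ) (x1 x2 : ι → ℝ) (y1 y2 : κ → ℝ) :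
    ∑ i, |w i * ((∑ j, H i j * (x2 j / w j))
        + clamp (x2 i / w i - (∑ j, P i j * (x2 j / w j))
            - (∑ k, Q i k * (y2 k / v k)) - e i) (c i) (d i))
      - w i * ((∑ j, H i j * (x1 j / w j))
        + clamp (x1 i / w i - (∑ j, P i j * (x1 j / w j))
            - (∑ k, Q i k * (y1 k / v k)) - e i) (c i) (d i))|
    ≤ ∑ j, (|1 - P j j| + |H j j|
          + ∑ i ∈ Finset.univ.erase j, (w i / w j) * (|P i j| + |H i j|)) * |x2 j - x1 j|
      + ∑ k, (∑ i, (w i / v k) * |Q i k|) * |y2 k - y1 k| := by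
  refine (Finset.sum_le_sum fun i _ => abs_weighted_clamp_sub_le hw hv (H i) (P i) (Q i)
    (e i) (c i) (d i) i x1 x2 y1 y2).trans_eq ?_
  simp only [Finset.sum_add_distrib, add_mul _ (∑ i ∈ Finset.univ.erase _, _), Finset.sum_mul]
  congr 1
  · congr 1
    exact Finset.sum_comm' fun i j => by simp [eq_comm]
  · exact Finset.sum_comm

/-- The column coefficient of a clamped block is at most the one computed from entrywise bounds. -/
theorem diag_column_coeff_le {ι : Type*} [Fintype ι] [DecidableEq ι] {w : ι → ℝ}
    (hw : ∀ i, 0 < w i) {r : ℝ} (hr : 0 < r) {L U M H : ι → ι → ℝ}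
    (hM : ∀ i j, L i j ≤ M i j ∧ M i j ≤ U i j) (hdiag : ∀ i, 1 - r * U i i ≥ H i i) (j : ι) :
    |1 - (r * M j j + H j j)| + |H j j|
      + ∑ i ∈ Finset.univ.erase j, (w i / w j) * (|r * M i j + H i j| + |H i j|)
    ≤ 1 - r * L j j - H j j + |H j j| + ∑ i ∈ Finset.univ.erase j,
      (w i / w j) * (max |r * L i j + H i j| |r * U i j + H i j| + |H i j|) := by
  have hl := fun i => mul_le_mul_of_nonneg_left (hM i j).1 hr.le
  have hu := fun i => mul_le_mul_of_nonneg_left (hM i j).2 hr.le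
  refine add_le_add ?_ (Finset.sum_le_sum fun i _ => ?_)
  · rw [abs_of_nonneg (by linarith [hdiag j, hu j])]
    linarith [hl j]
  · have := div_pos (hw i) (hw j)
    gcongr
    exact abs_le_max_abs_abs (by linarith [hl i]) (by linarith [hu i])

/-- The cross coefficient of a clamped block is at most the one computed from entrywise bounds. -/
theorem cross_column_coeff_le {ι κ : Type*} [Fintype ι] {w : ι → ℝ} {v : κ → ℝ}
    (hw : ∀ i, 0 < w i) (hv : ∀ k, 0 < v k) {r : ℝ} (hr : 0 < r) {L U M : ι → κ → ℝ}
    (hM : ∀ i k, L i k ≤ M i k ∧ M i k ≤ U i k) (k : κ) :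
    ∑ i, (w i / v k) * |r * M i k| ≤ ∑ i, (w i / v k) * (r * max |L i k| |U i k|) := by
  refine Finset.sum_le_sum fun i _ => ?_
  have := div_pos (hw i) (hv k)
  rw [abs_mul, abs_of_pos hr]
  gcongr
  exact abs_le_max_abs_abs (hM i k).1 (hM i k).2

/-- The Banach fixed point theorem on a product of two coordinate spaces with the `ℓ¹` norm. -/
theorem existsUnique_fixedPoint_of_l1_contraction {ι κ : Type*} [Fintype ι] [Fintype κ]
    (F : (ι → ℝ) → (κ → ℝ) → ι → ℝ) (G : (ι → ℝ) → (κ → ℝ) → κ → ℝ) {K : ℝ}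
    (hK0 : 0 ≤ K) (hK1 : K < 1)
    (hFG : ∀ (x1 x2 : ι → ℝ) (y1 y2 : κ → ℝ),
      (∑ i, |F x2 y2 i - F x1 y1 i|) + (∑ k, |G x2 y2 k - G x1 y1 k|)
        ≤ K * ((∑ i, |x2 i - x1 i|) + (∑ k, |y2 k - y1 k|))) :
    ∃! p : (ι → ℝ) × (κ → ℝ), F p.1 p.2 = p.1 ∧ G p.1 p.2 = p.2 := by
  let X := PiLp 1 (fun _ : ι ⊕ κ => ℝ)
  let Φ : X → X := fun z => WithLp.toLp 1
    (Sum.elim (F (fun i => z (.inl i)) (fun k => z (.inr k)))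
      (G (fun i => z (.inl i)) (fun k => z (.inr k))))
  have hΦ : ContractingWith ⟨K, hK0⟩ Φ := by
    refine ⟨hK1, LipschitzWith.of_dist_le_mul fun z z' => ?_⟩
    simp only [X, Φ, PiLp.dist_eq_of_L1, Fintype.sum_sum_type, Sum.elim_inl, Sum.elim_inr,
      Real.dist_eq]
    exact hFG _ _ _ _
  have hfix : ∀ p : (ι → ℝ) × (κ → ℝ), F p.1 p.2 = p.1 ∧ G p.1 p.2 = p.2 →
      Function.IsFixedPt Φ (WithLp.toLp 1 (Sum.elim p.1 p.2)) := by
    rintro p ⟨h1, h2⟩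
    simp [Function.IsFixedPt, Φ, h1, h2]
  obtain ⟨z, hz⟩ : ∃ z, Function.IsFixedPt Φ z := ⟨_, hΦ.fixedPoint_isFixedPt⟩
  refine ⟨(fun i => z (.inl i), fun k => z (.inr k)), ⟨?_, ?_⟩, fun p hp => ?_⟩
  · funext i
    exact congrArg (fun u : X => u (.inl i)) hz
  · funext k
    exact congrArg (fun u : X => u (.inr k)) hz
  · have := hΦ.fixedPoint_unique' (hfix p hp) hz
    subst this
    rfl

theorem stmt2
    (n m : ℕ) (hn : 0 < n) (hm : 0 < m)
    (ρ lam : ℝ) (hρ : 0 < ρ) (hlam : 0 < lam)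
    (a : Fin n → ℝ) (b : Fin m → ℝ)
    (Al Au A : Fin n → Fin n → ℝ)
    (Asl Asu As : Fin n → Fin m → ℝ)
    (hAb : ∀ i j, Al i j ≤ A i j ∧ A i j ≤ Au i j)
    (hAsb : ∀ i j, Asl i j ≤ As i j ∧ As i j ≤ Asu i j)
    (Bl Bu B : Fin m → Fin m → ℝ)
    (Bsl Bsu Bs : Fin m → Fin n → ℝ)
    (hBb : ∀ i j, Bl i j ≤ B i j ∧ B i j ≤ Bu i j)
    (hBsb : ∀ j i, Bsl j i ≤ Bs j i ∧ Bs j i ≤ Bsu j i)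
    (h : Fin n → Fin n → ℝ)
    (l : Fin m → Fin m → ℝ)
    (c1 c2 : Fin n → ℝ) (hc : ∀ i, c1 i ≤ c2 i)
    (d1 d2 : Fin m → ℝ) (hd : ∀ j, d1 j ≤ d2 j)
    (atil : Fin n → Fin n → ℝ)
    (hatil : ∀ j i, atil j i = max |ρ * Al j i + h j i| |ρ * Au j i + h j i|)
    (astil : Fin n → Fin m → ℝ)
    (hastil : ∀ i j, astil i j = max |Asl i j| |Asu i j|)
    (btil : Fin m → Fin m → ℝ)
    (hbtil : ∀ i j, btil i j = max |lam * Bl i j + l i j| |lam * Bu i j + l i j|)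
    (bstil : Fin m → Fin n → ℝ)
    (hbstil : ∀ j i, bstil j i = max |Bsl j i| |Bsu j i|)
    (hA2 : ∀ i, 1 - ρ * Au i i ≥ h i i)
    (hA3 : ∀ j, 1 - lam * Bu j j ≥ l j j)
    (μ : Fin n → ℝ) (τ : Fin m → ℝ)
    (hμ : ∀ i, 0 < μ i) (hτ : ∀ j, 0 < τ j)
    (ξ : Fin n → ℝ)
    (hξdef : ∀ i, ξ i = 1 - ρ * Al i i - h i i + |h i i|
        + ∑ j ∈ Finset.univ.erase i, (μ j / μ i) * (atil j i + |h j i|)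
        + ∑ j, (τ j / μ i) * (lam * bstil j i))
    (ζ : Fin m → ℝ)
    (hζdef : ∀ j, ζ j = 1 - lam * Bl j j - l j j + |l j j|
        + ∑ i ∈ Finset.univ.erase j, (τ i / τ j) * (btil i j + |l i j|)
        + ∑ i, (μ i / τ j) * (ρ * astil i j))
    (hA4 : (∀ i, 0 < ξ i ∧ ξ i < 1) ∧ (∀ j, 0 < ζ j ∧ ζ j < 1))
    (Tρ : (Fin n → ℝ) → (Fin m → ℝ) → Fin n → ℝ)
    (hTρ : ∀ x y i, Tρ x y i = μ i * ((∑ j, h i j * (x j / μ j))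
        + clamp (x i / μ i - (∑ j, (ρ * A i j + h i j) * (x j / μ j))
            - (∑ j, ρ * As i j * (y j / τ j)) - ρ * a i) (c1 i) (c2 i)))
    (Tlam : (Fin n → ℝ) → (Fin m → ℝ) → Fin m → ℝ)
    (hTlam : ∀ x y j, Tlam x y j = τ j * ((∑ i, l j i * (y i / τ i))
        + clamp (y j / τ j - (∑ i, (lam * B j i + l j i) * (y i / τ i))
            - (∑ i, lam * Bs j i * (x i / μ i)) - lam * b j) (d1 j) (d2 j)))
    (κ : ℝ) (hκ : IsGreatest (Set.range ξ ∪ Set.range ζ) κ)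
    :
    0 < κ ∧ κ < 1 ∧
    (∀ (x1 x2 : Fin n → ℝ) (y1 y2 : Fin m → ℝ),
      (∑ i, |Tρ x2 y2 i - Tρ x1 y1 i|) + (∑ j, |Tlam x2 y2 j - Tlam x1 y1 j|)
        ≤ κ * ((∑ i, |x2 i - x1 i|) + (∑ j, |y2 j - y1 j|))) ∧
    (∃! p : (Fin n → ℝ) × (Fin m → ℝ), Tρ p.1 p.2 = p.1 ∧ Tlam p.1 p.2 = p.2) := by
  have hκ0 : 0 < κ := by
    rcases hκ.1 with ⟨i, rfl⟩ | ⟨j, rfl⟩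
    exacts [(hA4.1 i).1, (hA4.2 j).1]
  have hκ1 : κ < 1 := by
    rcases hκ.1 with ⟨i, rfl⟩ | ⟨j, rfl⟩
    exacts [(hA4.1 i).2, (hA4.2 j).2]
  have hcontr : ∀ (x1 x2 : Fin n → ℝ) (y1 y2 : Fin m → ℝ),
      (∑ i, |Tρ x2 y2 i - Tρ x1 y1 i|) + (∑ j, |Tlam x2 y2 j - Tlam x1 y1 j|)
        ≤ κ * ((∑ i, |x2 i - x1 i|) + (∑ j, |y2 j - y1 j|)) := by
    intro x1 x2 y1 y2
    simp only [hTρ, hTlam]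
    refine (add_le_add
      (sum_abs_weighted_clamp_sub_le hμ hτ h (fun i j => ρ * A i j + h i j)
        (fun i j => ρ * As i j) (fun i => ρ * a i) c1 c2 x1 x2 y1 y2)
      (sum_abs_weighted_clamp_sub_le hτ hμ l (fun j i => lam * B j i + l j i)
        (fun j i => lam * Bs j i) (fun j => lam * b j) d1 d2 y1 y2 x1 x2)).trans ?_
    rw [add_comm (∑ j : Fin m, _ * |y2 j - y1 j|), add_add_add_comm, mul_add,
      ← Finset.sum_add_distrib, ← Finset.sum_add_distrib, Finset.mul_sum, Finset.mul_sum]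
    simp only [← add_mul]
    refine add_le_add (Finset.sum_le_sum fun i _ => ?_) (Finset.sum_le_sum fun j _ => ?_)
    · refine mul_le_mul_of_nonneg_right (le_trans ?_ (hκ.2 (.inl ⟨i, rfl⟩))) (abs_nonneg _)
      rw [hξdef]
      simp only [hatil, hbstil]
      exact add_le_add (diag_column_coeff_le hμ hρ hAb hA2 i)
        (cross_column_coeff_le hτ hμ hlam hBsb i)
    · refine mul_le_mul_of_nonneg_right (le_trans ?_ (hκ.2 (.inr ⟨j, rfl⟩))) (abs_nonneg _)
      rw [hζdef, add_comm]
      simp only [hbtil, hastil]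
      exact add_le_add (diag_column_coeff_le hτ hlam hBb hA3 j)
        (cross_column_coeff_le hμ hτ hρ hAsb j)
  exact ⟨hκ0, hκ1, hcontr, existsUnique_fixedPoint_of_l1_contraction Tρ Tlam hκ0.le hκ1 hcontr⟩
end

section
/- Fix weights μ_i > 0 and τ_j > 0 and assume (A2). For every index i with 1 ≤ i ≤ n and all (x¹, y¹), (x², y²) ∈ R^n × R^m, setting S_i(x, y) := x_i/μ_i − Σ_{j=1}^n (ρ a_ij + h_ij) x_j/μ_j − Σ_{j=1}^m ρ a*_ij y_j/τ_j − ρ a_i, one has |clamp(S_i(x², y²); c_{1,i}, c_{2,i}) − clamp(S_i(x¹, y¹); c_{1,i}, c_{2,i})| ≤ Σ_{j≠i} ã_ij |x²_j − x¹_j|/μ_j + (1 − ρ a̲_ii − h_ii) |x²_i − x¹_i|/μ_i + Σ_{j=1}^m ρ ã*_ij |y²_j − y¹_j|/τ_j. -/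
/-- The affine function `t ↦ r * t + k` attains its largest absolute value on `[l, u]` at an
endpoint. -/
theorem abs_mul_add_le_max {r l u t : ℝ} (hr : 0 ≤ r) (hl : l ≤ t) (hu : t ≤ u) (k : ℝ) :
    |r * t + k| ≤ max |r * l + k| |r * u + k| :=
  abs_le_max_abs_abs (by gcongr) (by gcongr)

theorem stmt4
    (n m : ℕ) (hn : 0 < n) (hm : 0 < m)
    (ρ lam : ℝ) (hρ : 0 < ρ) (hlam : 0 < lam)
    (a : Fin n → ℝ)
    (Al Au A : Fin n → Fin n → ℝ)
    (Asl Asu As : Fin n → Fin m → ℝ)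
    (hAb : ∀ i j, Al i j ≤ A i j ∧ A i j ≤ Au i j)
    (hAsb : ∀ i j, Asl i j ≤ As i j ∧ As i j ≤ Asu i j)
    (h : Fin n → Fin n → ℝ)
    (c1 c2 : Fin n → ℝ) (hc : ∀ i, c1 i ≤ c2 i)
    (atil : Fin n → Fin n → ℝ)
    (hatil : ∀ j i, atil j i = max |ρ * Al j i + h j i| |ρ * Au j i + h j i|)
    (astil : Fin n → Fin m → ℝ)
    (hastil : ∀ i j, astil i j = max |Asl i j| |Asu i j|)
    (hA2 : ∀ i, 1 - ρ * Au i i ≥ h i i)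
    (μ : Fin n → ℝ) (τ : Fin m → ℝ)
    (hμ : ∀ i, 0 < μ i) (hτ : ∀ j, 0 < τ j)
    :
    ∀ (i : Fin n) (x1 x2 : Fin n → ℝ) (y1 y2 : Fin m → ℝ),
      |clamp (x2 i / μ i - (∑ j, (ρ * A i j + h i j) * (x2 j / μ j))
            - (∑ j, ρ * As i j * (y2 j / τ j)) - ρ * a i) (c1 i) (c2 i)
        - clamp (x1 i / μ i - (∑ j, (ρ * A i j + h i j) * (x1 j / μ j))
            - (∑ j, ρ * As i j * (y1 j / τ j)) - ρ * a i) (c1 i) (c2 i)|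
        ≤ (∑ j ∈ Finset.univ.erase i, atil i j * (|x2 j - x1 j| / μ j))
          + (1 - ρ * Al i i - h i i) * (|x2 i - x1 i| / μ i)
          + (∑ j, ρ * astil i j * (|y2 j - y1 j| / τ j)) := by
  intro i x1 x2 y1 y2
  refine (abs_clamp_sub_clamp_le _ _ _ _).trans ?_
  have hdiff : (x2 i / μ i - (∑ j, (ρ * A i j + h i j) * (x2 j / μ j))
            - (∑ j, ρ * As i j * (y2 j / τ j)) - ρ * a i)
        - (x1 i / μ i - (∑ j, (ρ * A i j + h i j) * (x1 j / μ j))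
            - (∑ j, ρ * As i j * (y1 j / τ j)) - ρ * a i)
      = (1 - ρ * A i i - h i i) * ((x2 i - x1 i) / μ i)
        - (∑ j ∈ Finset.univ.erase i, (ρ * A i j + h i j) * ((x2 j - x1 j) / μ j))
        - (∑ j, ρ * As i j * ((y2 j - y1 j) / τ j)) := by
    simp only [← Finset.add_sum_erase _ _ (Finset.mem_univ i), sub_div, mul_sub,
      Finset.sum_sub_distrib]
    ring
  have hdiag : |(1 - ρ * A i i - h i i) * ((x2 i - x1 i) / μ i)|
      ≤ (1 - ρ * Al i i - h i i) * (|x2 i - x1 i| / μ i) := by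
    have hl := mul_le_mul_of_nonneg_left (hAb i i).1 hρ.le
    have hu := mul_le_mul_of_nonneg_left (hAb i i).2 hρ.le
    have h2 := hA2 i
    rw [abs_mul, abs_div, abs_of_pos (hμ i), abs_of_nonneg (by linarith)]
    exact mul_le_mul_of_nonneg_right (by linarith) (div_nonneg (abs_nonneg _) (hμ i).le)
  have hoff : |∑ j ∈ Finset.univ.erase i, (ρ * A i j + h i j) * ((x2 j - x1 j) / μ j)|
      ≤ ∑ j ∈ Finset.univ.erase i, atil i j * (|x2 j - x1 j| / μ j) := by
    refine (Finset.abs_sum_le_sum_abs _ _).trans (Finset.sum_le_sum fun j _ => ?_)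
    rw [abs_mul, abs_div, abs_of_pos (hμ j), hatil]
    exact mul_le_mul_of_nonneg_right (abs_mul_add_le_max hρ.le (hAb i j).1 (hAb i j).2 _)
      (div_nonneg (abs_nonneg _) (hμ j).le)
  have hy : |∑ j, ρ * As i j * ((y2 j - y1 j) / τ j)|
      ≤ ∑ j, ρ * astil i j * (|y2 j - y1 j| / τ j) := by
    refine (Finset.abs_sum_le_sum_abs _ _).trans (Finset.sum_le_sum fun j _ => ?_)
    rw [abs_mul, abs_mul, abs_div, abs_of_pos (hτ j), abs_of_pos hρ, hastil]
    exact mul_le_mul_of_nonneg_right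
      (mul_le_mul_of_nonneg_left (abs_le_max_abs_abs (hAsb i j).1 (hAsb i j).2) hρ.le)
      (div_nonneg (abs_nonneg _) (hτ j).le)
  rw [hdiff]
  linarith [abs_sub ((1 - ρ * A i i - h i i) * ((x2 i - x1 i) / μ i)
        - ∑ j ∈ Finset.univ.erase i, (ρ * A i j + h i j) * ((x2 j - x1 j) / μ j))
      (∑ j, ρ * As i j * ((y2 j - y1 j) / τ j)),
    abs_sub ((1 - ρ * A i i - h i i) * ((x2 i - x1 i) / μ i))
      (∑ j ∈ Finset.univ.erase i, (ρ * A i j + h i j) * ((x2 j - x1 j) / μ j))]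
end

section
/- Fix weights μ_i > 0 and τ_j > 0 and assume (A2). Then for all (x¹, y¹), (x², y²) ∈ R^n × R^m one has Σ_{i=1}^n |T_{ρ,i}(x², y²) − T_{ρ,i}(x¹, y¹)| ≤ Σ_{i=1}^n [ Σ_{j≠i} (μ_j/μ_i)(|h_ji| + ã_ji) + |h_ii| + 1 − ρ a̲_ii − h_ii ] |x²_i − x¹_i| + Σ_{j=1}^m Σ_{i=1}^n (μ_i/τ_j) ρ ã*_ij |y²_j − y¹_j|. -/
theorem abs_mul_add_le_max_abs_s5 {ρ l b u k : ℝ} (hρ : 0 ≤ ρ) (hl : l ≤ b) (hu : b ≤ u) :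
    |ρ * b + k| ≤ max |ρ * l + k| |ρ * u + k| :=
  abs_le_max_abs_abs (by gcongr) (by gcongr)

/-- Swapping the order of summation after splitting off the diagonal. -/
theorem sum_sum_ite_diag {ι : Type*} [Fintype ι] [DecidableEq ι] (d : ι → ℝ) (e : ι → ι → ℝ) :
    ∑ i, ∑ j, (if j = i then d j else e i j) =
      ∑ j, ((∑ i ∈ Finset.univ.erase j, e i j) + d j) := by
  rw [Finset.sum_comm]
  refine Finset.sum_congr rfl fun j _ => ?_
  rw [← Finset.sum_erase_add _ _ (Finset.mem_univ j), if_pos rfl]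
  congr 1
  exact Finset.sum_congr rfl fun i hi => if_neg (Finset.ne_of_mem_erase hi).symm

theorem stmt5
    (n m : ℕ) (hn : 0 < n) (hm : 0 < m)
    (ρ lam : ℝ) (hρ : 0 < ρ) (hlam : 0 < lam)
    (a : Fin n → ℝ)
    (Al Au A : Fin n → Fin n → ℝ)
    (Asl Asu As : Fin n → Fin m → ℝ)
    (hAb : ∀ i j, Al i j ≤ A i j ∧ A i j ≤ Au i j)
    (hAsb : ∀ i j, Asl i j ≤ As i j ∧ As i j ≤ Asu i j)
    (h : Fin n → Fin n → ℝ)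
    (c1 c2 : Fin n → ℝ) (hc : ∀ i, c1 i ≤ c2 i)
    (atil : Fin n → Fin n → ℝ)
    (hatil : ∀ j i, atil j i = max |ρ * Al j i + h j i| |ρ * Au j i + h j i|)
    (astil : Fin n → Fin m → ℝ)
    (hastil : ∀ i j, astil i j = max |Asl i j| |Asu i j|)
    (hA2 : ∀ i, 1 - ρ * Au i i ≥ h i i)
    (μ : Fin n → ℝ) (τ : Fin m → ℝ)
    (hμ : ∀ i, 0 < μ i) (hτ : ∀ j, 0 < τ j)
    (Tρ : (Fin n → ℝ) → (Fin m → ℝ) → Fin n → ℝ)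
    (hTρ : ∀ x y i, Tρ x y i = μ i * ((∑ j, h i j * (x j / μ j))
        + clamp (x i / μ i - (∑ j, (ρ * A i j + h i j) * (x j / μ j))
            - (∑ j, ρ * As i j * (y j / τ j)) - ρ * a i) (c1 i) (c2 i)))
    :
    ∀ (x1 x2 : Fin n → ℝ) (y1 y2 : Fin m → ℝ),
      (∑ i, |Tρ x2 y2 i - Tρ x1 y1 i|)
        ≤ (∑ i, ((∑ j ∈ Finset.univ.erase i, (μ j / μ i) * (|h j i| + atil j i))
              + |h i i| + 1 - ρ * Al i i - h i i) * |x2 i - x1 i|)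
          + (∑ j, ∑ i, (μ i / τ j) * (ρ * astil i j) * |y2 j - y1 j|) := by
  intro x1 x2 y1 y2
  set dx : Fin n → ℝ := fun j => (x2 j - x1 j) / μ j with hdx
  set dy : Fin m → ℝ := fun j => (y2 j - y1 j) / τ j with hdy
  have abs_dx : ∀ j, |dx j| = |x2 j - x1 j| / μ j := fun j => by
    rw [hdx, abs_div, abs_of_pos (hμ j)]
  have abs_dy : ∀ j, |dy j| = |y2 j - y1 j| / τ j := fun j => by
    rw [hdy, abs_div, abs_of_pos (hτ j)]
  have row : ∀ i, |Tρ x2 y2 i - Tρ x1 y1 i| ≤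
      (∑ j, if j = i then (|h j j| + 1 - ρ * Al j j - h j j) * |x2 j - x1 j|
        else (μ i / μ j) * (|h i j| + atil i j) * |x2 j - x1 j|)
      + ∑ j, (μ i / τ j) * (ρ * astil i j) * |y2 j - y1 j| := by
    intro i
    set arg : (Fin n → ℝ) → (Fin m → ℝ) → ℝ := fun x y =>
      x i / μ i - (∑ j, (ρ * A i j + h i j) * (x j / μ j))
        - (∑ j, ρ * As i j * (y j / τ j)) - ρ * a i with harg
    have arg_sub : arg x2 y2 - arg x1 y1 =
        (∑ j, ((if j = i then 1 else 0) - (ρ * A i j + h i j)) * dx j)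
          - ∑ j, ρ * As i j * dy j := by
      simp only [harg, hdx, hdy, sub_div, mul_sub, sub_mul, Finset.sum_sub_distrib, ite_mul,
        one_mul, zero_mul, Finset.sum_ite_eq', Finset.mem_univ, if_true]
      ring
    have T_sub : Tρ x2 y2 i - Tρ x1 y1 i = μ i * ((∑ j, h i j * dx j)
        + (clamp (arg x2 y2) (c1 i) (c2 i) - clamp (arg x1 y1) (c1 i) (c2 i))) := by
      rw [hTρ, hTρ]
      simp only [hdx, sub_div, mul_sub, Finset.sum_sub_distrib]
      ring
    calc |Tρ x2 y2 i - Tρ x1 y1 i|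
        ≤ μ i * ((∑ j, |h i j * dx j|)
            + ((∑ j, |((if j = i then 1 else 0) - (ρ * A i j + h i j)) * dx j|)
              + ∑ j, |ρ * As i j * dy j|)) := by
          rw [T_sub, abs_mul, abs_of_pos (hμ i)]
          refine mul_le_mul_of_nonneg_left ?_ (hμ i).le
          refine (abs_add_le _ _).trans (add_le_add (Finset.abs_sum_le_sum_abs _ _) ?_)
          refine (abs_clamp_sub_clamp_le _ _ _ _).trans ?_
          rw [arg_sub]
          exact (abs_sub _ _).trans
            (add_le_add (Finset.abs_sum_le_sum_abs _ _) (Finset.abs_sum_le_sum_abs _ _))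
      _ = (∑ j, μ i * (|h i j| + |(if j = i then 1 else 0) - (ρ * A i j + h i j)|) * |dx j|)
            + ∑ j, μ i * (ρ * |As i j|) * |dy j| := by
          simp only [abs_mul, abs_of_pos hρ, mul_add, add_mul, Finset.mul_sum,
            Finset.sum_add_distrib, mul_assoc, add_assoc]
      _ ≤ _ := by
          refine add_le_add (Finset.sum_le_sum fun j _ => ?_) (Finset.sum_le_sum fun j _ => ?_)
          · split_ifs with hji
            · subst hji
              have hlo := mul_le_mul_of_nonneg_left (hAb j j).1 hρ.le
              have hup := mul_le_mul_of_nonneg_left (hAb j j).2 hρ.le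
              have diag : |1 - (ρ * A j j + h j j)| ≤ 1 - ρ * Al j j - h j j := by
                rw [abs_of_nonneg (by linarith [hA2 j])]
                linarith
              calc μ j * (|h j j| + |1 - (ρ * A j j + h j j)|) * |dx j|
                  = (|h j j| + |1 - (ρ * A j j + h j j)|) * |x2 j - x1 j| := by
                    rw [abs_dx]
                    field_simp [(hμ j).ne']
                _ ≤ _ := mul_le_mul_of_nonneg_right (by linarith) (abs_nonneg _)
            · have off : |0 - (ρ * A i j + h i j)| ≤ atil i j := by
                rw [zero_sub, abs_neg, hatil]
                exact abs_mul_add_le_max_abs_s5 hρ.le (hAb i j).1 (hAb i j).2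
              calc μ i * (|h i j| + |0 - (ρ * A i j + h i j)|) * |dx j|
                  ≤ μ i * (|h i j| + atil i j) * |dx j| := by
                    have := (hμ i).le
                    gcongr
                _ = _ := by rw [abs_dx]; ring
          · have star : |As i j| ≤ astil i j := by
              rw [hastil]
              exact abs_le_max_abs_abs (hAsb i j).1 (hAsb i j).2
            calc μ i * (ρ * |As i j|) * |dy j| ≤ μ i * (ρ * astil i j) * |dy j| := by
                  have := (hμ i).le
                  gcongr
              _ = _ := by rw [abs_dy]; ring
  refine (Finset.sum_le_sum fun i _ => row i).trans (le_of_eq ?_)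
  rw [Finset.sum_add_distrib, sum_sum_ite_diag, Finset.sum_comm (γ := Fin m)]
  congr 1
  refine Finset.sum_congr rfl fun i _ => ?_
  rw [← Finset.sum_mul]
  ring
end

section
/- Fix weights μ_i > 0 and τ_j > 0 and assume (A2). Then for all (x¹, y¹), (x², y²) ∈ R^n × R^m one has Σ_{i=1}^n μ_i sgn(x²_i − x¹_i) (F₁,i(x², y²) − F₁,i(x¹, y¹)) ≤ Σ_{i=1}^n [ Σ_{j≠i} (μ_j/μ_i)(|h_ji| + ã_ji) + |h_ii| − ρ a̲_ii − h_ii ] μ_i |x²_i − x¹_i| + Σ_{j=1}^m Σ_{i=1}^n μ_i ρ ã*_ij |y²_j − y¹_j|. -/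
/-- A signed increment of `clamp` is bounded by the positive part of the signed increment of its
argument. -/
lemma sgn_mul_clamp_sub_le (t u v : ℝ) {c d : ℝ} (hcd : c ≤ d) :
    sgn t * (clamp u c d - clamp v c d) ≤ max 0 (sgn t * (u - v)) := by
  unfold sgn clamp
  split_ifs <;> grind

lemma sgn_mul_self_eq_abs (t : ℝ) : sgn t * t = |t| := by
  unfold sgn
  grind

lemma abs_sgn_le_one (t : ℝ) : |sgn t| ≤ 1 := by
  unfold sgn
  split_ifs <;> simp

lemma sgn_mul_le_abs (t u : ℝ) : sgn t * u ≤ |u| :=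
  calc sgn t * u ≤ |sgn t * u| := le_abs_self _
    _ = |sgn t| * |u| := abs_mul _ _
    _ ≤ |u| := mul_le_of_le_one_left (abs_nonneg u) (abs_sgn_le_one t)

lemma sgn_mul_sum_le {ι : Type*} (s : Finset ι) (t : ℝ) (b B d : ι → ℝ)
    (hb : ∀ j ∈ s, |b j| ≤ B j) :
    sgn t * ∑ j ∈ s, b j * d j ≤ ∑ j ∈ s, B j * |d j| := by
  rw [Finset.mul_sum]
  refine Finset.sum_le_sum fun j hj => (sgn_mul_le_abs t _).trans ?_
  rw [abs_mul]
  exact mul_le_mul_of_nonneg_right (hb j hj) (abs_nonneg _)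

/-- The estimate of a single neuron: `p` are the weights subtracted inside the clamp, `q` the
weights of the second layer. -/
lemma sgn_mul_clamp_network_sub_le {ι κ : Type*} [Fintype ι] [DecidableEq ι] [Fintype κ]
    (i : ι) (w p P : ι → ℝ) (q Q : κ → ℝ) (l b c d : ℝ) (hcd : c ≤ d)
    (hl : l ≤ p i) (hp : p i ≤ 1) (hP : ∀ j, |p j| ≤ P j) (hQ : ∀ j, |q j| ≤ Q j)
    (x₁ x₂ : ι → ℝ) (y₁ y₂ : κ → ℝ) :
    sgn (x₂ i - x₁ i) *
        (((∑ j, w j * x₂ j) +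
            clamp (x₂ i - (∑ j, p j * x₂ j) - (∑ j, q j * y₂ j) - b) c d - x₂ i) -
          ((∑ j, w j * x₁ j) +
            clamp (x₁ i - (∑ j, p j * x₁ j) - (∑ j, q j * y₁ j) - b) c d - x₁ i)) ≤
      (|w i| - l) * |x₂ i - x₁ i| +
        ∑ j ∈ Finset.univ.erase i, (|w j| + P j) * |x₂ j - x₁ j| +
        ∑ j, Q j * |y₂ j - y₁ j| := by
  have split (r : ι → ℝ) : (∑ j, r j * x₂ j) - ∑ j, r j * x₁ j =
      r i * (x₂ i - x₁ i) + ∑ j ∈ Finset.univ.erase i, r j * (x₂ j - x₁ j) := by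
    rw [Finset.add_sum_erase _ (fun j => r j * (x₂ j - x₁ j)) (Finset.mem_univ i),
      ← Finset.sum_sub_distrib]
    simp only [mul_sub]
  have hy : (∑ j, q j * y₂ j) - ∑ j, q j * y₁ j = ∑ j, q j * (y₂ j - y₁ j) := by
    rw [← Finset.sum_sub_distrib]
    simp only [mul_sub]
  have hw := split w
  have hpx := split p
  have hclamp := sgn_mul_clamp_sub_le (x₂ i - x₁ i)
    (x₂ i - (∑ j, p j * x₂ j) - (∑ j, q j * y₂ j) - b)
    (x₁ i - (∑ j, p j * x₁ j) - (∑ j, q j * y₁ j) - b) hcd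
  have hself := sgn_mul_self_eq_abs (x₂ i - x₁ i)
  have hwi := sgn_mul_le_abs (x₂ i - x₁ i) (w i * (x₂ i - x₁ i))
  rw [abs_mul] at hwi
  have hwsum := sgn_mul_sum_le (Finset.univ.erase i) (x₂ i - x₁ i) w (fun j => |w j|)
    (fun j => x₂ j - x₁ j) fun _ _ => le_rfl
  have hpsum := sgn_mul_sum_le (Finset.univ.erase i) (x₂ i - x₁ i) (fun j => -p j) P
    (fun j => x₂ j - x₁ j) fun j _ => by simpa using hP j
  have hqsum := sgn_mul_sum_le Finset.univ (x₂ i - x₁ i) (fun j => -q j) Q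
    (fun j => y₂ j - y₁ j) fun j _ => by simpa using hQ j
  simp only [neg_mul, Finset.sum_neg_distrib] at hpsum hqsum
  have hP0 : 0 ≤ ∑ j ∈ Finset.univ.erase i, P j * |x₂ j - x₁ j| :=
    Finset.sum_nonneg fun j _ => mul_nonneg ((abs_nonneg _).trans (hP j)) (abs_nonneg _)
  have hQ0 : 0 ≤ ∑ j, Q j * |y₂ j - y₁ j| :=
    Finset.sum_nonneg fun j _ => mul_nonneg ((abs_nonneg _).trans (hQ j)) (abs_nonneg _)
  have hl' : l * |x₂ i - x₁ i| ≤ p i * |x₂ i - x₁ i| :=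
    mul_le_mul_of_nonneg_right hl (abs_nonneg _)
  have hp' : p i * |x₂ i - x₁ i| ≤ 1 * |x₂ i - x₁ i| :=
    mul_le_mul_of_nonneg_right hp (abs_nonneg _)
  have hmax : max 0 (sgn (x₂ i - x₁ i) *
      ((x₂ i - (∑ j, p j * x₂ j) - (∑ j, q j * y₂ j) - b) -
        (x₁ i - (∑ j, p j * x₁ j) - (∑ j, q j * y₁ j) - b))) ≤
      (1 - l) * |x₂ i - x₁ i| + ∑ j ∈ Finset.univ.erase i, P j * |x₂ j - x₁ j| +
        ∑ j, Q j * |y₂ j - y₁ j| := by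
    refine max_le (by linarith) ?_
    calc _ = (1 - p i) * (sgn (x₂ i - x₁ i) * (x₂ i - x₁ i)) +
          sgn (x₂ i - x₁ i) * -(∑ j ∈ Finset.univ.erase i, p j * (x₂ j - x₁ j)) +
          sgn (x₂ i - x₁ i) * -(∑ j, q j * (y₂ j - y₁ j)) := by
          linear_combination -sgn (x₂ i - x₁ i) * (hpx + hy)
      _ ≤ _ := by
        rw [hself]
        linarith
  simp only [add_mul, Finset.sum_add_distrib]
  have hw' : sgn (x₂ i - x₁ i) * ((∑ j, w j * x₂ j) - ∑ j, w j * x₁ j) =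
      sgn (x₂ i - x₁ i) * (w i * (x₂ i - x₁ i)) +
      sgn (x₂ i - x₁ i) * ∑ j ∈ Finset.univ.erase i, w j * (x₂ j - x₁ j) := by
    rw [hw, mul_add]
  linarith

lemma sum_mul_sum_erase_eq {ι : Type*} [Fintype ι] [DecidableEq ι] (μ d : ι → ℝ)
    (hμ : ∀ i, μ i ≠ 0) (B : ι → ι → ℝ) :
    ∑ i, μ i * ∑ j ∈ Finset.univ.erase i, B i j * d j =
      ∑ i, (∑ j ∈ Finset.univ.erase i, μ j / μ i * B j i) * (μ i * d i) := by
  simp only [Finset.mul_sum, Finset.sum_mul]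
  rw [Finset.sum_comm' (s' := fun j => Finset.univ.erase j) (t' := Finset.univ)
    (by simp [eq_comm])]
  refine Finset.sum_congr rfl fun j _ => Finset.sum_congr rfl fun i _ => ?_
  have := hμ j
  field_simp

theorem stmt7
    (n m : ℕ) (hn : 0 < n) (hm : 0 < m)
    (ρ : ℝ) (hρ : 0 < ρ)
    (a : Fin n → ℝ)
    (Al Au A : Fin n → Fin n → ℝ)
    (Asl Asu As : Fin n → Fin m → ℝ)
    (hAb : ∀ i j, Al i j ≤ A i j ∧ A i j ≤ Au i j)
    (hAsb : ∀ i j, Asl i j ≤ As i j ∧ As i j ≤ Asu i j)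
    (h : Fin n → Fin n → ℝ)
    (c1 c2 : Fin n → ℝ) (hc : ∀ i, c1 i ≤ c2 i)
    (atil : Fin n → Fin n → ℝ)
    (hatil : ∀ j i, atil j i = max |ρ * Al j i + h j i| |ρ * Au j i + h j i|)
    (astil : Fin n → Fin m → ℝ)
    (hastil : ∀ i j, astil i j = max |Asl i j| |Asu i j|)
    (hA2 : ∀ i, 1 - ρ * Au i i ≥ h i i)
    (μ : Fin n → ℝ) (τ : Fin m → ℝ)
    (hμ : ∀ i, 0 < μ i) (hτ : ∀ j, 0 < τ j)
    (F1 : (Fin n → ℝ) → (Fin m → ℝ) → Fin n → ℝ)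
    (hF1 : ∀ x y i, F1 x y i = (∑ j, h i j * x j)
        + clamp (x i - (∑ j, (ρ * A i j + h i j) * x j)
            - (∑ j, ρ * As i j * y j) - ρ * a i) (c1 i) (c2 i) - x i)
    :
    ∀ (x1 x2 : Fin n → ℝ) (y1 y2 : Fin m → ℝ),
      (∑ i, μ i * sgn (x2 i - x1 i) * (F1 x2 y2 i - F1 x1 y1 i))
        ≤ (∑ i, ((∑ j ∈ Finset.univ.erase i, (μ j / μ i) * (|h j i| + atil j i))
              + |h i i| - ρ * Al i i - h i i) * (μ i * |x2 i - x1 i|))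
          + (∑ j, ∑ i, μ i * (ρ * astil i j) * |y2 j - y1 j|) := by
  intro x1 x2 y1 y2
  have hatil_bound (i j) : |ρ * A i j + h i j| ≤ atil i j := by
    rw [hatil]
    have := mul_le_mul_of_nonneg_left (hAb i j).1 hρ.le
    have := mul_le_mul_of_nonneg_left (hAb i j).2 hρ.le
    exact abs_le_max_abs_abs (by linarith) (by linarith)
  have hastil_bound (i j) : |ρ * As i j| ≤ ρ * astil i j := by
    rw [hastil, abs_mul, abs_of_pos hρ]
    exact mul_le_mul_of_nonneg_left (abs_le_max_abs_abs (hAsb i j).1 (hAsb i j).2) hρ.le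
  have hrow (i) := sgn_mul_clamp_network_sub_le i (h i) (fun j => ρ * A i j + h i j) (atil i)
    (fun j => ρ * As i j) (fun j => ρ * astil i j) (ρ * Al i i + h i i) (ρ * a i) _ _ (hc i)
    (by have := mul_le_mul_of_nonneg_left (hAb i i).1 hρ.le; linarith)
    (by have := mul_le_mul_of_nonneg_left (hAb i i).2 hρ.le; linarith [hA2 i])
    (hatil_bound i) (hastil_bound i) x1 x2 y1 y2
  simp only [← hF1] at hrow
  calc _ ≤ ∑ i, μ i * ((|h i i| - (ρ * Al i i + h i i)) * |x2 i - x1 i| +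
          ∑ j ∈ Finset.univ.erase i, (|h i j| + atil i j) * |x2 j - x1 j| +
          ∑ j, ρ * astil i j * |y2 j - y1 j|) := by
        refine Finset.sum_le_sum fun i _ => ?_
        rw [mul_assoc]
        exact mul_le_mul_of_nonneg_left (hrow i) (hμ i).le
    _ = _ := by
        simp only [mul_add, Finset.sum_add_distrib]
        rw [sum_mul_sum_erase_eq μ (fun j => |x2 j - x1 j|) (fun i => (hμ i).ne')
          (fun i j => |h i j| + atil i j), ← Finset.sum_add_distrib, Finset.sum_comm (γ := Fin m)]
        congr 1
        · refine Finset.sum_congr rfl fun i _ => ?_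
          simp only [mul_add, Finset.sum_add_distrib]
          ring
        · simp only [Finset.mul_sum, mul_assoc]
end

section
/- Assume (H1), (H2) and (H3). Then the system of fractional-order interval projection neural networks with fixed constraint boxes has a unique equilibrium point: there exists a unique pair (x*, y*) ∈ R^n × R^m such that for every i = 1,…,n: x*_i = clamp( x*_i − ρ(Σ_{j=1}^n a_ij x*_j + Σ_{j=1}^m a*_ij y*_j) − ρ a_i ; c_{1,i}, c_{2,i} ), and for every j = 1,…,m: y*_j = clamp( y*_j − λ(Σ_{i=1}^m b_ji y*_i + Σ_{i=1}^n b*_ji x*_i) − λ b_j ; d_{1,j}, d_{2,j} ). -/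
theorem clamp_mem_Icc {c d : ℝ} (h : c ≤ d) (s : ℝ) : clamp s c d ∈ Set.Icc c d :=
  ⟨le_min (le_max_right _ _) h, min_le_right _ _⟩

theorem sum_weighted_abs_sub_lt {ι : Type*} [Fintype ι] {f : (ι → ℝ) → ι → ℝ}
    {L : ι → ι → ℝ} {w : ι → ℝ} (hw : ∀ k, 0 < w k)
    (hf : ∀ x y k, |f x k - f y k| ≤ ∑ l, L k l * |x l - y l|)
    (hL : ∀ l, ∑ k, w k * L k l < w l) {x y : ι → ℝ} (hxy : x ≠ y) :
    ∑ k, w k * |f x k - f y k| < ∑ k, w k * |x k - y k| := by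
  obtain ⟨l₀, hl₀⟩ := Function.ne_iff.mp hxy
  calc ∑ k, w k * |f x k - f y k|
      ≤ ∑ k, w k * ∑ l, L k l * |x l - y l| :=
        Finset.sum_le_sum fun k _ => mul_le_mul_of_nonneg_left (hf x y k) (hw k).le
    _ = ∑ l, (∑ k, w k * L k l) * |x l - y l| := by
        simp only [Finset.mul_sum, Finset.sum_mul, mul_assoc]
        exact Finset.sum_comm
    _ < ∑ l, w l * |x l - y l| :=
        Finset.sum_lt_sum (fun l _ => mul_le_mul_of_nonneg_right (hL l).le (abs_nonneg _))
          ⟨l₀, Finset.mem_univ _,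
            mul_lt_mul_of_pos_right (hL l₀) (abs_pos.mpr (sub_ne_zero.mpr hl₀))⟩

theorem existsUnique_fixedPoint_of_weighted_column_sums_lt {ι : Type*} [Fintype ι]
    {f : (ι → ℝ) → ι → ℝ} {L : ι → ι → ℝ} {w : ι → ℝ} {S : Set (ι → ℝ)}
    (hS : IsCompact S) (hne : S.Nonempty) (hmaps : Set.MapsTo f S S) (hcont : Continuous f)
    (hw : ∀ k, 0 < w k) (hf : ∀ x y k, |f x k - f y k| ≤ ∑ l, L k l * |x l - y l|)
    (hL : ∀ l, ∑ k, w k * L k l < w l) : ∃! x, x = f x := by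
  obtain ⟨x, hxS, hx⟩ := hS.exists_isMinOn hne
    (f := fun x => ∑ k, w k * |f x k - x k|) (by fun_prop)
  have hfx : x = f x := by
    by_contra h
    exact (sum_weighted_abs_sub_lt hw hf hL (Ne.symm h)).not_ge (hx (hmaps hxS))
  refine ⟨x, hfx, fun y hy => ?_⟩
  by_contra h
  have hlt := sum_weighted_abs_sub_lt hw hf hL h
  rw [← hy, ← hfx] at hlt
  exact hlt.false

theorem existsUnique_clamp_equilibrium {ι : Type*} [Fintype ι] [DecidableEq ι]
    (M : ι → ι → ℝ) (q lo hi w : ι → ℝ) (hbox : ∀ k, lo k ≤ hi k) (hw : ∀ k, 0 < w k)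
    (hL : ∀ l, ∑ k, w k * |(if k = l then 1 else 0) - M k l| < w l) :
    ∃! z : ι → ℝ, z = fun k => clamp (z k - ∑ l, M k l * z l - q k) (lo k) (hi k) := by
  refine existsUnique_fixedPoint_of_weighted_column_sums_lt (S := Set.Icc lo hi)
    (f := fun z k => clamp (z k - ∑ l, M k l * z l - q k) (lo k) (hi k))
    isCompact_Icc (Set.nonempty_Icc.mpr hbox)
    (fun z _ => ⟨fun k => (clamp_mem_Icc (hbox k) _).1, fun k => (clamp_mem_Icc (hbox k) _).2⟩)
    (by unfold clamp; fun_prop) hw (fun x y k => ?_) hL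
  calc _ ≤ _ := abs_clamp_sub_clamp_le _ _ _ _
    _ = |∑ l, ((if k = l then 1 else 0) - M k l) * (x l - y l)| := by
        congr 1
        simp only [sub_mul, mul_sub, Finset.sum_sub_distrib, ite_mul, one_mul, zero_mul,
          Finset.sum_ite_eq, Finset.mem_univ, if_true]
        ring
    _ ≤ ∑ l, |((if k = l then 1 else 0) - M k l) * (x l - y l)| :=
        Finset.abs_sum_le_sum_abs _ _
    _ = _ := by simp only [abs_mul]

theorem sum_weighted_abs_delta_sub_le {ι : Type*} [Fintype ι] [DecidableEq ι]
    {N Nl Nu : ι → ι → ℝ} {r : ℝ} (hr : 0 < r) {w : ι → ℝ} (hw : ∀ k, 0 < w k)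
    (hN : ∀ i j, Nl i j ≤ N i j ∧ N i j ≤ Nu i j) (hdiag : ∀ i, 0 ≤ 1 - r * Nu i i) (i : ι) :
    ∑ k, w k * |(if k = i then 1 else 0) - r * N k i| ≤
      w i * (1 - r * Nl i i) + ∑ k ∈ Finset.univ.erase i, w k * (r * max |Nl k i| |Nu k i|) := by
  rw [← Finset.add_sum_erase _ _ (Finset.mem_univ i)]
  refine add_le_add ?_ (Finset.sum_le_sum fun k hk => ?_)
  · have h₁ := mul_le_mul_of_nonneg_left (hN i i).1 hr.le
    have h₂ := mul_le_mul_of_nonneg_left (hN i i).2 hr.le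
    rw [if_pos rfl, abs_of_nonneg (by linarith [hdiag i])]
    exact mul_le_mul_of_nonneg_left (by linarith) (hw i).le
  · rw [if_neg (Finset.ne_of_mem_erase hk), zero_sub, abs_neg, abs_mul, abs_of_pos hr]
    exact mul_le_mul_of_nonneg_left
      (mul_le_mul_of_nonneg_left (abs_le_max_abs_abs (hN k i).1 (hN k i).2) hr.le) (hw k).le

theorem sum_weighted_abs_le {ι κ : Type*} [Fintype ι]
    {N Nl Nu : ι → κ → ℝ} {r : ℝ} (hr : 0 < r) {w : ι → ℝ} (hw : ∀ k, 0 < w k)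
    (hN : ∀ i j, Nl i j ≤ N i j ∧ N i j ≤ Nu i j) (l : κ) :
    ∑ k, w k * |r * N k l| ≤ ∑ k, w k * (r * max |Nl k l| |Nu k l|) := by
  refine Finset.sum_le_sum fun k _ => mul_le_mul_of_nonneg_left ?_ (hw k).le
  rw [abs_mul, abs_of_pos hr]
  exact mul_le_mul_of_nonneg_left (abs_le_max_abs_abs (hN k l).1 (hN k l).2) hr.le

theorem weighted_sum_lt_of_normalized_lt_one {ι κ : Type*} {s : Finset ι} {t : Finset κ}
    {w d : ℝ} (hw : 0 < w) {u g : ι → ℝ} {v h : κ → ℝ}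
    (hlt : d + ∑ k ∈ s, u k / w * g k + ∑ k ∈ t, v k / w * h k < 1) :
    w * d + ∑ k ∈ s, u k * g k + ∑ k ∈ t, v k * h k < w := by
  have := mul_lt_mul_of_pos_left hlt hw
  simpa only [mul_add, Finset.mul_sum, ← mul_assoc, mul_div_cancel₀ _ hw.ne', mul_one] using this

theorem stmt9
    (n m : ℕ) (hn : 0 < n) (hm : 0 < m)
    (ρ lam : ℝ) (hρ : 0 < ρ) (hlam : 0 < lam)
    (a : Fin n → ℝ) (b : Fin m → ℝ)
    (Al Au A : Fin n → Fin n → ℝ)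
    (Asl Asu As : Fin n → Fin m → ℝ)
    (hAb : ∀ i j, Al i j ≤ A i j ∧ A i j ≤ Au i j)
    (hAsb : ∀ i j, Asl i j ≤ As i j ∧ As i j ≤ Asu i j)
    (Bl Bu B : Fin m → Fin m → ℝ)
    (Bsl Bsu Bs : Fin m → Fin n → ℝ)
    (hBb : ∀ i j, Bl i j ≤ B i j ∧ B i j ≤ Bu i j)
    (hBsb : ∀ j i, Bsl j i ≤ Bs j i ∧ Bs j i ≤ Bsu j i)
    (c1 c2 : Fin n → ℝ) (hc : ∀ i, c1 i ≤ c2 i)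
    (d1 d2 : Fin m → ℝ) (hd : ∀ j, d1 j ≤ d2 j)
    (ahat : Fin n → Fin n → ℝ)
    (hahat : ∀ j i, ahat j i = max |Al j i| |Au j i|)
    (ashat : Fin n → Fin m → ℝ)
    (hashat : ∀ i j, ashat i j = max |Asl i j| |Asu i j|)
    (bhat : Fin m → Fin m → ℝ)
    (hbhat : ∀ i j, bhat i j = max |Bl i j| |Bu i j|)
    (bshat : Fin m → Fin n → ℝ)
    (hbshat : ∀ j i, bshat j i = max |Bsl j i| |Bsu j i|)
    (hH1 : ∀ i, 1 - ρ * Au i i ≥ 0)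
    (hH2 : ∀ j, 1 - lam * Bu j j ≥ 0)
    (μ : Fin n → ℝ) (τ : Fin m → ℝ)
    (hμ : ∀ i, 0 < μ i) (hτ : ∀ j, 0 < τ j)
    (η : Fin n → ℝ)
    (hηdef : ∀ i, η i = 1 - ρ * Al i i
        + (∑ j ∈ Finset.univ.erase i, (μ j / μ i) * (ρ * ahat j i))
        + (∑ j, (τ j / μ i) * (lam * bshat j i)))
    (ν : Fin m → ℝ)
    (hνdef : ∀ j, ν j = 1 - lam * Bl j j
        + (∑ i ∈ Finset.univ.erase j, (τ i / τ j) * (lam * bhat i j))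
        + (∑ i, (μ i / τ j) * (ρ * ashat i j)))
    (hH3 : (∀ i, 0 < η i ∧ η i < 1) ∧ (∀ j, 0 < ν j ∧ ν j < 1))
    :
    ∃! p : (Fin n → ℝ) × (Fin m → ℝ),
      (∀ i, p.1 i = clamp (p.1 i - ρ * ((∑ j, A i j * p.1 j) + (∑ j, As i j * p.2 j))
          - ρ * a i) (c1 i) (c2 i)) ∧
      (∀ j, p.2 j = clamp (p.2 j - lam * ((∑ i, B j i * p.2 i) + (∑ i, Bs j i * p.1 i))
          - lam * b j) (d1 j) (d2 j)) := by
  have hcolx (i : Fin n) : (∑ k, μ k * |(if k = i then 1 else 0) - ρ * A k i|)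
      + ∑ j, τ j * |lam * Bs j i| < μ i := by
    have h := (hH3.1 i).2
    simp only [hηdef, hahat, hbshat] at h
    exact (add_le_add (sum_weighted_abs_delta_sub_le hρ hμ hAb hH1 i)
      (sum_weighted_abs_le hlam hτ hBsb i)).trans_lt
        (weighted_sum_lt_of_normalized_lt_one (hμ i) h)
  have hcoly (j : Fin m) : (∑ k, τ k * |(if k = j then 1 else 0) - lam * B k j|)
      + ∑ i, μ i * |ρ * As i j| < τ j := by
    have h := (hH3.2 j).2
    simp only [hνdef, hbhat, hashat] at h
    exact (add_le_add (sum_weighted_abs_delta_sub_le hlam hτ hBb hH2 j)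
      (sum_weighted_abs_le hρ hμ hAsb j)).trans_lt
        (weighted_sum_lt_of_normalized_lt_one (hτ j) h)
  have key := existsUnique_clamp_equilibrium (ι := Fin n ⊕ Fin m)
    (Sum.elim (fun i => Sum.elim (fun j => ρ * A i j) (fun j => ρ * As i j))
      (fun j => Sum.elim (fun i => lam * Bs j i) (fun i => lam * B j i)))
    (Sum.elim (fun i => ρ * a i) (fun j => lam * b j))
    (Sum.elim c1 d1) (Sum.elim c2 d2) (Sum.elim μ τ)
    (by rintro (i | j) <;> simp [hc, hd]) (by rintro (i | j) <;> simp [hμ, hτ])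
    (by
      rintro (i | j)
      · simpa using hcolx i
      · simpa [add_comm] using hcoly j)
  rw [← (Equiv.sumArrowEquivProdArrow (Fin n) (Fin m) ℝ).existsUnique_congr_right]
  refine (existsUnique_congr fun z => ?_).mp key
  simp only [funext_iff, Sum.forall, Fintype.sum_sum_type, Sum.elim_inl, Sum.elim_inr,
    Equiv.sumArrowEquivProdArrow, Equiv.coe_fn_mk, Function.comp_apply, mul_assoc,
    ← Finset.mul_sum, ← mul_add]
  refine and_congr Iff.rfl (forall_congr' fun j => ?_)
  rw [add_comm (∑ i, Bs j i * _)]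
end

section
/- Assume (H1), (H2) and (H3), and set θ := min{ min_{1≤i≤n}(1 − η_i), min_{1≤j≤m}(1 − ν_j) }, so θ > 0. Then for all (x¹, y¹), (x², y²) ∈ R^n × R^m the vector field of the fixed-box projection neural network satisfies Σ_{i=1}^n μ_i sgn(x²_i − x¹_i) (G₁,i(x², y²) − G₁,i(x¹, y¹)) + Σ_{j=1}^m τ_j sgn(y²_j − y¹_j) (G₂,j(x², y²) − G₂,j(x¹, y¹)) ≤ −θ ( Σ_{i=1}^n μ_i |x²_i − x¹_i| + Σ_{j=1}^m τ_j |y²_j − y¹_j| ). (This is the Lyapunov decrease estimate from which the global Mittag-Leffler stability in Corollary 3.1 is deduced.) -/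
theorem sgn_mul_sub_le (d C : ℝ) : sgn d * (C - d) ≤ |C| - |d| := by
  unfold sgn
  split_ifs with h1 h2
  · rw [abs_of_pos h1]
    linarith [le_abs_self C]
  · rw [abs_of_neg h2]
    linarith [neg_le_abs C]
  · have : d = 0 := le_antisymm (not_lt.mp h1) (not_lt.mp h2)
    simp [this]

theorem abs_mul_sum_le {κ : Type*} {ρ : ℝ} (hρ : 0 ≤ ρ) (s : Finset κ) (γ γhat f : κ → ℝ)
    (h : ∀ j, |γ j| ≤ γhat j) :
    |ρ * ∑ j ∈ s, γ j * f j| ≤ ∑ j ∈ s, ρ * γhat j * |f j| := by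
  rw [Finset.mul_sum]
  refine (Finset.abs_sum_le_sum_abs _ _).trans (Finset.sum_le_sum fun j _ => ?_)
  rw [abs_mul, abs_mul, abs_of_nonneg hρ, mul_assoc]
  gcongr
  exact h j

theorem abs_sub_le_abs_add_abs (x y : ℝ) : |x - y| ≤ |x| + |y| := by
  simpa [sub_eq_add_neg] using abs_add_le x (-y)

theorem abs_affine_step_le {ι κ : Type*} [Fintype ι] [DecidableEq ι] [Fintype κ] {ρ l : ℝ}
    (hρ : 0 ≤ ρ) (i : ι) (α αhat d : ι → ℝ) (β βhat e : κ → ℝ)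
    (hl : l ≤ α i) (hα : 0 ≤ 1 - ρ * α i)
    (hαhat : ∀ j, |α j| ≤ αhat j) (hβhat : ∀ j, |β j| ≤ βhat j) :
    |d i - ρ * (∑ j, α j * d j + ∑ j, β j * e j)| ≤
      (1 - ρ * l) * |d i| + ∑ j ∈ Finset.univ.erase i, ρ * αhat j * |d j|
        + ∑ j, ρ * βhat j * |e j| := by
  have hsplit : d i - ρ * (∑ j, α j * d j + ∑ j, β j * e j) =
      (1 - ρ * α i) * d i - ρ * ∑ j ∈ Finset.univ.erase i, α j * d j
        - ρ * ∑ j, β j * e j := by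
    rw [← Finset.add_sum_erase _ (fun j => α j * d j) (Finset.mem_univ i)]
    ring
  have hdiag : |(1 - ρ * α i) * d i| ≤ (1 - ρ * l) * |d i| := by
    rw [abs_mul, abs_of_nonneg hα]
    gcongr
  rw [hsplit]
  refine (abs_sub_le_abs_add_abs _ _).trans
    (add_le_add ((abs_sub_le_abs_add_abs _ _).trans (add_le_add hdiag ?_)) ?_)
  · exact abs_mul_sum_le hρ _ _ _ _ hαhat
  · exact abs_mul_sum_le hρ _ _ _ _ hβhat

theorem sum_sgn_mul_layer_le {ι κ : Type*} [Fintype ι] [DecidableEq ι] [Fintype κ] {ρ : ℝ}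
    (hρ : 0 < ρ) (a : ι → ℝ) (Al Au A : ι → ι → ℝ) (Asl Asu As : ι → κ → ℝ)
    (hAb : ∀ i j, Al i j ≤ A i j ∧ A i j ≤ Au i j)
    (hAsb : ∀ i j, Asl i j ≤ As i j ∧ As i j ≤ Asu i j)
    (c₁ c₂ : ι → ℝ) (ahat : ι → ι → ℝ) (hahat : ∀ i j, ahat i j = max |Al i j| |Au i j|)
    (ashat : ι → κ → ℝ) (hashat : ∀ i j, ashat i j = max |Asl i j| |Asu i j|)
    (hAu : ∀ i, 1 - ρ * Au i i ≥ 0) (μ : ι → ℝ) (hμ : ∀ i, 0 < μ i)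
    (G : (ι → ℝ) → (κ → ℝ) → ι → ℝ)
    (hG : ∀ x y i, G x y i = clamp (x i - ρ * ((∑ j, A i j * x j) + (∑ j, As i j * y j))
        - ρ * a i) (c₁ i) (c₂ i) - x i)
    (x₁ x₂ : ι → ℝ) (y₁ y₂ : κ → ℝ) :
    ∑ i, μ i * sgn (x₂ i - x₁ i) * (G x₂ y₂ i - G x₁ y₁ i) ≤
      ∑ i, (μ i * (1 - ρ * Al i i) + ∑ j ∈ Finset.univ.erase i, μ j * (ρ * ahat j i))
          * |x₂ i - x₁ i|
        + ∑ j, (∑ i, μ i * (ρ * ashat i j)) * |y₂ j - y₁ j| - ∑ i, μ i * |x₂ i - x₁ i| := by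
  have hpt : ∀ i, μ i * sgn (x₂ i - x₁ i) * (G x₂ y₂ i - G x₁ y₁ i) ≤
      μ i * ((1 - ρ * Al i i) * |x₂ i - x₁ i|
        + ∑ j ∈ Finset.univ.erase i, ρ * ahat i j * |x₂ j - x₁ j|
        + ∑ j, ρ * ashat i j * |y₂ j - y₁ j| - |x₂ i - x₁ i|) := by
    intro i
    rw [mul_assoc]
    refine mul_le_mul_of_nonneg_left ?_ (hμ i).le
    have hstep := abs_affine_step_le hρ.le i (A i) (ahat i) (fun j => x₂ j - x₁ j)
      (As i) (ashat i) (fun j => y₂ j - y₁ j) (hAb i i).1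
      (by nlinarith [hAu i, (hAb i i).2])
      (fun j => hahat i j ▸ abs_le_max_abs_abs (hAb i j).1 (hAb i j).2)
      (fun j => hashat i j ▸ abs_le_max_abs_abs (hAsb i j).1 (hAsb i j).2)
    rw [hG, hG, sub_sub_sub_comm]
    refine (sgn_mul_sub_le _ _).trans (sub_le_sub_right ?_ _)
    refine (abs_clamp_sub_clamp_le _ _ _ _).trans (le_trans (le_of_eq ?_) hstep)
    simp only [mul_sub, Finset.sum_sub_distrib]
    congr 1
    ring
  have hswap : ∑ i, ∑ j ∈ Finset.univ.erase i, μ i * (ρ * ahat i j * |x₂ j - x₁ j|) =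
      ∑ i, ∑ j ∈ Finset.univ.erase i, μ j * (ρ * ahat j i * |x₂ i - x₁ i|) :=
    Finset.sum_comm' (by simp [eq_comm])
  have hswap' : ∑ i, ∑ j, μ i * (ρ * ashat i j * |y₂ j - y₁ j|) =
      ∑ j, ∑ i, μ i * (ρ * ashat i j * |y₂ j - y₁ j|) := Finset.sum_comm
  refine (Finset.sum_le_sum fun i _ => hpt i).trans (le_of_eq ?_)
  simp only [mul_sub (μ _) (_ + _), mul_add (μ _), Finset.sum_sub_distrib, Finset.sum_add_distrib,
    Finset.mul_sum, hswap, hswap', add_mul, Finset.sum_mul]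
  simp only [mul_assoc]

theorem stmt10
    (n m : ℕ) (hn : 0 < n) (hm : 0 < m)
    (ρ lam : ℝ) (hρ : 0 < ρ) (hlam : 0 < lam)
    (a : Fin n → ℝ) (b : Fin m → ℝ)
    (Al Au A : Fin n → Fin n → ℝ)
    (Asl Asu As : Fin n → Fin m → ℝ)
    (hAb : ∀ i j, Al i j ≤ A i j ∧ A i j ≤ Au i j)
    (hAsb : ∀ i j, Asl i j ≤ As i j ∧ As i j ≤ Asu i j)
    (Bl Bu B : Fin m → Fin m → ℝ)
    (Bsl Bsu Bs : Fin m → Fin n → ℝ)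
    (hBb : ∀ i j, Bl i j ≤ B i j ∧ B i j ≤ Bu i j)
    (hBsb : ∀ j i, Bsl j i ≤ Bs j i ∧ Bs j i ≤ Bsu j i)
    (c1 c2 : Fin n → ℝ) (hc : ∀ i, c1 i ≤ c2 i)
    (d1 d2 : Fin m → ℝ) (hd : ∀ j, d1 j ≤ d2 j)
    (ahat : Fin n → Fin n → ℝ)
    (hahat : ∀ j i, ahat j i = max |Al j i| |Au j i|)
    (ashat : Fin n → Fin m → ℝ)
    (hashat : ∀ i j, ashat i j = max |Asl i j| |Asu i j|)
    (bhat : Fin m → Fin m → ℝ)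
    (hbhat : ∀ i j, bhat i j = max |Bl i j| |Bu i j|)
    (bshat : Fin m → Fin n → ℝ)
    (hbshat : ∀ j i, bshat j i = max |Bsl j i| |Bsu j i|)
    (hH1 : ∀ i, 1 - ρ * Au i i ≥ 0)
    (hH2 : ∀ j, 1 - lam * Bu j j ≥ 0)
    (μ : Fin n → ℝ) (τ : Fin m → ℝ)
    (hμ : ∀ i, 0 < μ i) (hτ : ∀ j, 0 < τ j)
    (η : Fin n → ℝ)
    (hηdef : ∀ i, η i = 1 - ρ * Al i i
        + (∑ j ∈ Finset.univ.erase i, (μ j / μ i) * (ρ * ahat j i))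
        + (∑ j, (τ j / μ i) * (lam * bshat j i)))
    (ν : Fin m → ℝ)
    (hνdef : ∀ j, ν j = 1 - lam * Bl j j
        + (∑ i ∈ Finset.univ.erase j, (τ i / τ j) * (lam * bhat i j))
        + (∑ i, (μ i / τ j) * (ρ * ashat i j)))
    (hH3 : (∀ i, 0 < η i ∧ η i < 1) ∧ (∀ j, 0 < ν j ∧ ν j < 1))
    (G1 : (Fin n → ℝ) → (Fin m → ℝ) → Fin n → ℝ)
    (hG1 : ∀ x y i, G1 x y i = clamp (x i - ρ * ((∑ j, A i j * x j) + (∑ j, As i j * y j))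
        - ρ * a i) (c1 i) (c2 i) - x i)
    (G2 : (Fin n → ℝ) → (Fin m → ℝ) → Fin m → ℝ)
    (hG2 : ∀ x y j, G2 x y j = clamp (y j - lam * ((∑ i, B j i * y i) + (∑ i, Bs j i * x i))
        - lam * b j) (d1 j) (d2 j) - y j)
    (θ : ℝ)
    (hθ : IsLeast (Set.range (fun i => 1 - η i) ∪ Set.range (fun j => 1 - ν j)) θ)
    :
    0 < θ ∧
    ∀ (x1 x2 : Fin n → ℝ) (y1 y2 : Fin m → ℝ),
      (∑ i, μ i * sgn (x2 i - x1 i) * (G1 x2 y2 i - G1 x1 y1 i))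
        + (∑ j, τ j * sgn (y2 j - y1 j) * (G2 x2 y2 j - G2 x1 y1 j))
        ≤ -θ * ((∑ i, μ i * |x2 i - x1 i|) + (∑ j, τ j * |y2 j - y1 j|)) := by
  have hθpos : 0 < θ := by
    rcases hθ.1 with ⟨i, rfl⟩ | ⟨j, rfl⟩
    · exact sub_pos.mpr (hH3.1 i).2
    · exact sub_pos.mpr (hH3.2 j).2
  refine ⟨hθpos, fun x1 x2 y1 y2 => ?_⟩
  have hx := sum_sgn_mul_layer_le hρ a Al Au A Asl Asu As hAb hAsb c1 c2 ahat hahat ashat hashat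
    hH1 μ hμ G1 hG1 x1 x2 y1 y2
  have hy := sum_sgn_mul_layer_le hlam b Bl Bu B Bsl Bsu Bs hBb hBsb d1 d2 bhat hbhat bshat hbshat
    hH2 τ hτ (fun y x => G2 x y) (fun y x j => hG2 x y j) y1 y2 x1 x2
  have hη : ∀ i, μ i * (1 - ρ * Al i i) + (∑ j ∈ Finset.univ.erase i, μ j * (ρ * ahat j i))
      + ∑ j, τ j * (lam * bshat j i) = μ i * η i := by
    intro i
    have hcancel (t s : ℝ) : μ i * (t / μ i * s) = t * s := by
      rw [← mul_assoc, mul_div_cancel₀ _ (hμ i).ne']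
    simp only [hηdef, mul_add, Finset.mul_sum, hcancel]
  have hν : ∀ j, τ j * (1 - lam * Bl j j) + (∑ i ∈ Finset.univ.erase j, τ i * (lam * bhat i j))
      + ∑ i, μ i * (ρ * ashat i j) = τ j * ν j := by
    intro j
    have hcancel (t s : ℝ) : τ j * (t / τ j * s) = t * s := by
      rw [← mul_assoc, mul_div_cancel₀ _ (hτ j).ne']
    simp only [hνdef, mul_add, Finset.mul_sum, hcancel]
  have hxθ : ∑ i, μ i * η i * |x2 i - x1 i| ≤ (1 - θ) * ∑ i, μ i * |x2 i - x1 i| := by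
    rw [Finset.mul_sum]
    refine Finset.sum_le_sum fun i _ => ?_
    have hi : θ ≤ 1 - η i := hθ.2 (Or.inl ⟨i, rfl⟩)
    have : 0 ≤ μ i * |x2 i - x1 i| := mul_nonneg (hμ i).le (abs_nonneg _)
    nlinarith
  have hyθ : ∑ j, τ j * ν j * |y2 j - y1 j| ≤ (1 - θ) * ∑ j, τ j * |y2 j - y1 j| := by
    rw [Finset.mul_sum]
    refine Finset.sum_le_sum fun j _ => ?_
    have hj : θ ≤ 1 - ν j := hθ.2 (Or.inr ⟨j, rfl⟩)
    have : 0 ≤ τ j * |y2 j - y1 j| := mul_nonneg (hτ j).le (abs_nonneg _)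
    nlinarith
  simp only [← hη, ← hν, add_mul _ (∑ _, _) |_|, Finset.sum_add_distrib] at hxθ hyθ
  linarith
end

section
/- Suppose there exist weights μ_i > 0 (1 ≤ i ≤ n) such that δ_i := 1 − Σ_{j≠i} (μ_j/μ_i) ρ |a_ji| − |1 − ρ a_ii| > 0 for every i. Then the global fractional-order projective dynamical system has a unique equilibrium point: there exists a unique x* ∈ R^n with x*_i = clamp( x*_i − ρ Σ_{j=1}^n a_ij x*_j − ρ a_i ; c_{1,i}, c_{2,i} ) for all i = 1,…,n. -/
theorem continuous_clamp (c d : ℝ) : Continuous fun s => clamp s c d := by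
  unfold clamp
  fun_prop

/-- Edelstein's fixed point theorem: a continuous map that preserves a nonempty compact set and
strictly decreases a continuous gauge `V` between distinct points has a fixed point there. -/
theorem exists_fixedPoint_of_strict_decrease {X : Type*} [TopologicalSpace X] {K : Set X}
    (hK : IsCompact K) (hne : K.Nonempty) {T : X → X} (hT : Continuous T)
    (hmaps : Set.MapsTo T K K) {V : X → X → ℝ} (hV : Continuous (Function.uncurry V))
    (hlt : ∀ x y, x ≠ y → V (T x) (T y) < V x y) : ∃ x ∈ K, T x = x := by
  have hcont : Continuous fun x => V x (T x) := hV.comp (continuous_id.prodMk hT)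
  obtain ⟨x, hx, hmin⟩ := hK.exists_isMinOn hne hcont.continuousOn
  refine ⟨x, hx, ?_⟩
  by_contra hfix
  exact (hlt x (T x) (Ne.symm hfix)).not_ge (hmin (hmaps hx))

/-- Strict column diagonal dominance with weights `μ` makes `1 - ρ A` strictly decrease the
`μ`-weighted `ℓ¹` norm. -/
theorem sum_mul_abs_sub_mul_sum_lt {ι : Type*} [Fintype ι] [DecidableEq ι] {ρ : ℝ} (hρ : 0 < ρ)
    (A : ι → ι → ℝ) {μ : ι → ℝ} (hμ : ∀ i, 0 < μ i)
    (hdom : ∀ i, ∑ j ∈ Finset.univ.erase i, (μ j / μ i) * (ρ * |A j i|) + |1 - ρ * A i i| < 1)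
    {d : ι → ℝ} (hd : d ≠ 0) :
    ∑ i, μ i * |d i - ρ * ∑ j, A i j * d j| < ∑ i, μ i * |d i| := by
  set M : ι → ι → ℝ := fun i j => if j = i then |1 - ρ * A i i| else ρ * |A i j| with hM
  have hrow : ∀ i, |d i - ρ * ∑ j, A i j * d j| ≤ ∑ j, M i j * |d j| := by
    intro i
    have hsum : d i - ρ * ∑ j, A i j * d j
        = ∑ j, ((if j = i then 1 else 0) - ρ * A i j) * d j := by
      simp [sub_mul, Finset.sum_sub_distrib, Finset.mul_sum, mul_assoc]
    rw [hsum]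
    refine (Finset.abs_sum_le_sum_abs _ _).trans (Finset.sum_le_sum fun j _ => ?_)
    rw [abs_mul]
    by_cases h : j = i
    · simp [hM, h]
    · simp [hM, h, abs_mul, abs_of_pos hρ]
  have hcol : ∀ j, ∑ i, μ i * M i j < μ j := by
    intro j
    have h := mul_lt_mul_of_pos_left (hdom j) (hμ j)
    rw [mul_one, mul_add, Finset.mul_sum] at h
    rw [← Finset.sum_erase_add _ _ (Finset.mem_univ j)]
    have hdiag : M j j = |1 - ρ * A j j| := by simp [hM]
    rw [hdiag]
    refine lt_of_eq_of_lt (congrArg (· + _) (Finset.sum_congr rfl fun i hi => ?_)) h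
    have hij : j ≠ i := (Finset.ne_of_mem_erase hi).symm
    have := (hμ j).ne'
    simp only [hM, if_neg hij]
    field_simp
  obtain ⟨k, hk⟩ := Function.ne_iff.mp hd
  calc ∑ i, μ i * |d i - ρ * ∑ j, A i j * d j|
      ≤ ∑ i, μ i * ∑ j, M i j * |d j| :=
        Finset.sum_le_sum fun i _ => mul_le_mul_of_nonneg_left (hrow i) (hμ i).le
    _ = ∑ j, (∑ i, μ i * M i j) * |d j| := by
        simp only [Finset.mul_sum, Finset.sum_mul, mul_assoc]
        exact Finset.sum_comm
    _ < ∑ j, μ j * |d j| :=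
        Finset.sum_lt_sum (fun j _ => mul_le_mul_of_nonneg_right (hcol j).le (abs_nonneg _))
          ⟨k, Finset.mem_univ k, mul_lt_mul_of_pos_right (hcol k) (abs_pos.mpr hk)⟩

theorem stmt11
    (n : ℕ) (hn : 0 < n)
    (ρ : ℝ) (hρ : 0 < ρ)
    (A : Fin n → Fin n → ℝ) (a : Fin n → ℝ)
    (c1 c2 : Fin n → ℝ) (hc : ∀ i, c1 i ≤ c2 i)
    (μ : Fin n → ℝ) (hμ : ∀ i, 0 < μ i)
    (δ : Fin n → ℝ)
    (hδdef : ∀ i, δ i = 1 - (∑ j ∈ Finset.univ.erase i, (μ j / μ i) * (ρ * |A j i|))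
        - |1 - ρ * A i i|)
    (hδpos : ∀ i, 0 < δ i)
    :
    ∃! x : Fin n → ℝ, ∀ i, x i = clamp (x i - ρ * (∑ j, A i j * x j) - ρ * a i) (c1 i) (c2 i) := by
  set T : (Fin n → ℝ) → Fin n → ℝ := fun x i =>
    clamp (x i - ρ * (∑ j, A i j * x j) - ρ * a i) (c1 i) (c2 i)
  have hlt : ∀ x y, x ≠ y → ∑ i, μ i * |T x i - T y i| < ∑ i, μ i * |x i - y i| := by
    intro x y hxy
    refine (Finset.sum_le_sum fun i _ => mul_le_mul_of_nonneg_left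
      (abs_clamp_sub_clamp_le _ _ _ _) (hμ i).le).trans_lt ?_
    have h := sum_mul_abs_sub_mul_sum_lt hρ A hμ (fun i => by linarith [hδdef i, hδpos i])
      (sub_ne_zero.mpr hxy)
    refine lt_of_eq_of_lt (Finset.sum_congr rfl fun i _ => congrArg (μ i * |·|) ?_) h
    simp only [Pi.sub_apply, mul_sub, Finset.sum_sub_distrib]
    ring
  have hT : Continuous T :=
    continuous_pi fun i => (continuous_clamp (c1 i) (c2 i)).comp (by fun_prop)
  obtain ⟨x, -, hx⟩ := exists_fixedPoint_of_strict_decrease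
    (K := Set.Icc c1 c2) isCompact_Icc ⟨c1, le_rfl, hc⟩ hT
    (fun x _ => ⟨fun i => (clamp_mem_Icc (hc i) _).1, fun i => (clamp_mem_Icc (hc i) _).2⟩)
    (V := fun x y => ∑ i, μ i * |x i - y i|) (by unfold Function.uncurry; fun_prop) hlt
  refine ⟨x, fun i => (congrFun hx i).symm, fun y hy => ?_⟩
  by_contra hyx
  have h := hlt y x hyx
  rw [hx, show T y = y from funext fun i => (hy i).symm] at h
  exact lt_irrefl _ h
end

section
/- Suppose there exist weights μ_i > 0 (1 ≤ i ≤ n) such that δ_i := 1 − Σ_{j≠i} (μ_j/μ_i) ρ |a_ji| − |1 − ρ a_ii| > 0 for every i, and set θ := min_{1≤i≤n} δ_i. Then the map H(x) defined componentwise by H_i(x) := clamp( x_i − ρ Σ_{j=1}^n a_ij x_j − ρ a_i ; c_{1,i}, c_{2,i} ) is a contraction with constant 1 − θ < 1 in the weighted ℓ¹ norm ‖x‖_μ := Σ_{i=1}^n μ_i |x_i|: for all x¹, x² ∈ R^n, Σ_{i=1}^n μ_i |H_i(x²) − H_i(x¹)| ≤ (1 − θ) Σ_{i=1}^n μ_i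 |x²_i − x¹_i|. -/
/-- A matrix whose weighted absolute column sums are at most `q` is `q`-Lipschitz in the
weighted `ℓ¹` norm. -/
theorem sum_mul_abs_sum_mul_le {ι : Type*} [Fintype ι] (μ : ι → ℝ) (hμ : ∀ i, 0 ≤ μ i)
    (B : ι → ι → ℝ) (q : ℝ) (hB : ∀ j, ∑ i, μ i * |B i j| ≤ q * μ j) (d : ι → ℝ) :
    ∑ i, μ i * |∑ j, B i j * d j| ≤ q * ∑ j, μ j * |d j| :=
  calc ∑ i, μ i * |∑ j, B i j * d j|
      ≤ ∑ i, μ i * ∑ j, |B i j * d j| :=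
        Finset.sum_le_sum fun i _ =>
          mul_le_mul_of_nonneg_left (Finset.abs_sum_le_sum_abs _ _) (hμ i)
    _ = ∑ j, (∑ i, μ i * |B i j|) * |d j| := by
        simp only [Finset.mul_sum, Finset.sum_mul, abs_mul, mul_assoc]
        exact Finset.sum_comm
    _ ≤ ∑ j, q * μ j * |d j| :=
        Finset.sum_le_sum fun j _ => mul_le_mul_of_nonneg_right (hB j) (abs_nonneg _)
    _ = q * ∑ j, μ j * |d j| := by
        simp only [Finset.mul_sum, mul_assoc]

theorem stmt13
    (n : ℕ) (hn : 0 < n)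
    (ρ : ℝ) (hρ : 0 < ρ)
    (A : Fin n → Fin n → ℝ) (a : Fin n → ℝ)
    (c1 c2 : Fin n → ℝ) (hc : ∀ i, c1 i ≤ c2 i)
    (μ : Fin n → ℝ) (hμ : ∀ i, 0 < μ i)
    (δ : Fin n → ℝ)
    (hδdef : ∀ i, δ i = 1 - (∑ j ∈ Finset.univ.erase i, (μ j / μ i) * (ρ * |A j i|))
        - |1 - ρ * A i i|)
    (hδpos : ∀ i, 0 < δ i)
    (θ : ℝ) (hθ : IsLeast (Set.range δ) θ)
    (H : (Fin n → ℝ) → Fin n → ℝ)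
    (hH : ∀ x i, H x i = clamp (x i - ρ * (∑ j, A i j * x j) - ρ * a i) (c1 i) (c2 i))
    :
    1 - θ < 1 ∧
    ∀ (x1 x2 : Fin n → ℝ),
      (∑ i, μ i * |H x2 i - H x1 i|) ≤ (1 - θ) * ∑ i, μ i * |x2 i - x1 i| := by
  obtain ⟨⟨k, hk⟩, hle⟩ := hθ
  refine ⟨by linarith [hδpos k], fun x1 x2 => ?_⟩
  set B : Fin n → Fin n → ℝ := fun i j => (if i = j then 1 else 0) - ρ * A i j with hBdef
  have hcol (j : Fin n) : ∑ i, μ i * |B i j| ≤ (1 - θ) * μ j := by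
    have hoff : ∑ i ∈ Finset.univ.erase j, μ i * |B i j| =
        μ j * ∑ i ∈ Finset.univ.erase j, (μ i / μ j) * (ρ * |A i j|) := by
      rw [Finset.mul_sum]
      refine Finset.sum_congr rfl fun i hi => ?_
      have hμj := (hμ j).ne'
      simp only [hBdef, if_neg (Finset.ne_of_mem_erase hi), zero_sub, abs_neg, abs_mul,
        abs_of_pos hρ]
      field_simp
    have hdiag : B j j = 1 - ρ * A j j := by simp [hBdef]
    have hθj : θ ≤ δ j := hle ⟨j, rfl⟩
    rw [← Finset.add_sum_erase _ _ (Finset.mem_univ j), hoff, hdiag, ← mul_add,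
      mul_comm (1 - θ)]
    exact mul_le_mul_of_nonneg_left (by linarith [hδdef j]) (hμ j).le
  refine le_trans (Finset.sum_le_sum fun i _ => mul_le_mul_of_nonneg_left ?_ (hμ i).le)
    (sum_mul_abs_sum_mul_le μ (fun i => (hμ i).le) B (1 - θ) hcol fun j => x2 j - x1 j)
  rw [hH, hH]
  refine (abs_clamp_sub_clamp_le _ _ _ _).trans_eq (congrArg _ ?_)
  simp only [hBdef, sub_mul, mul_sub, ite_mul, one_mul, zero_mul, Finset.sum_sub_distrib,
    Finset.sum_ite_eq, Finset.mem_univ, if_true, mul_assoc, ← Finset.mul_sum]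
  ring
end
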